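/- arXiv:1409.4524 — 3 statements merged into one kernel-verified Lean document; each statement's English description precedes it below -/
import Mathlib

section
/- Assume M is irreducible and ρ(M) = 0. For y ∈ ℝⁿ set v(y) := sup { limsup_{t→∞} ‖x(t)‖ : x a solution of the linear switched system with x(0) = y }. Then v(y) is finite for every y ∈ ℝⁿ, v is a norm on ℝⁿ, and v is a Barabanov norm, i.e.: (1) v(x(t)) ≤ v(x(0)) for every solution x and every t ≥ 0; (2) for every y ∈ ℝⁿ there exists a solution x with x(0) = y and v(x(t)) = v(y) for all t ≥ 0. -/
open MeasureTheory Filter Topology RealInnerProductSpace Matrix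

noncomputable section

abbrev Vec (n : ℕ) := EuclideanSpace ℝ (Fin n)

def mulE {n : ℕ} (A : Matrix (Fin n) (Fin n) ℝ) (y : Vec n) : Vec n :=
  Matrix.toEuclideanLin A y

def IsSolutionWith {n : ℕ} (M : Set (Matrix (Fin n) (Fin n) ℝ))
    (A : ℝ → Matrix (Fin n) (Fin n) ℝ) (x : ℝ → Vec n) : Prop :=
  (∀ i j, Measurable fun t => A t i j) ∧ (∀ t, A t ∈ M) ∧
    ContinuousOn x (Set.Ici 0) ∧
    ∀ t ≥ (0:ℝ), x t = x 0 + ∫ s in (0:ℝ)..t, mulE (A s) (x s)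

def IsSolution {n : ℕ} (M : Set (Matrix (Fin n) (Fin n) ℝ)) (x : ℝ → Vec n) : Prop :=
  ∃ A, IsSolutionWith M A x

def IsAdjointWith {n : ℕ} (A : ℝ → Matrix (Fin n) (Fin n) ℝ) (l : ℝ → Vec n) : Prop :=
  ContinuousOn l (Set.Ici 0) ∧
    ∀ t ≥ (0:ℝ), l t = l 0 - ∫ s in (0:ℝ)..t, mulE ((A s)ᵀ) (l s)

def IsNorm {n : ℕ} (v : Vec n → ℝ) : Prop :=
  (∀ x, v x = 0 ↔ x = 0) ∧ (∀ (a : ℝ) (x : Vec n), v (a • x) = |a| * v x) ∧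
    ∀ x y, v (x + y) ≤ v x + v y

def IsBarabanov {n : ℕ} (M : Set (Matrix (Fin n) (Fin n) ℝ)) (v : Vec n → ℝ) : Prop :=
  IsNorm v ∧ (∀ x, IsSolution M x → ∀ t ≥ (0:ℝ), v (x t) ≤ v (x 0)) ∧
    ∀ y : Vec n, ∃ x, IsSolution M x ∧ x 0 = y ∧ ∀ t ≥ (0:ℝ), v (x t) = v y

def IsExtremal {n : ℕ} (M : Set (Matrix (Fin n) (Fin n) ℝ)) (v : Vec n → ℝ)
    (x : ℝ → Vec n) : Prop :=
  IsSolution M x ∧ ∀ t ≥ (0:ℝ), v (x t) = v (x 0)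

def subdiff {n : ℕ} (v : Vec n → ℝ) (x : Vec n) : Set (Vec n) :=
  {l | ⟪l, x⟫ = v x ∧ ∀ y, ⟪l, y⟫ ≤ v y}

def MIrreducible {n : ℕ} (M : Set (Matrix (Fin n) (Fin n) ℝ)) : Prop :=
  ∀ W : Submodule ℝ (Vec n), (∀ A ∈ M, ∀ x ∈ W, mulE A x ∈ W) → W = ⊥ ∨ W = ⊤

def rhoZero {n : ℕ} (M : Set (Matrix (Fin n) (Fin n) ℝ)) : Prop :=
  sSup {r : EReal | ∃ x, IsSolution M x ∧ x 0 ≠ 0 ∧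
      r = limsup (fun t => ((Real.log ‖x t‖ / t : ℝ) : EReal)) atTop} = 0

def MaxCondWith {n : ℕ} (M : Set (Matrix (Fin n) (Fin n) ℝ))
    (A : ℝ → Matrix (Fin n) (Fin n) ℝ) (x l : ℝ → Vec n) : Prop :=
  ∀ᵐ t ∂(volume.restrict (Set.Ici (0:ℝ))),
    ∀ B ∈ M, ⟪l t, mulE B (x t)⟫ ≤ ⟪l t, mulE (A t) (x t)⟫

def ConditionG {n : ℕ} (M : Set (Matrix (Fin n) (Fin n) ℝ)) : Prop :=
  ∀ (x₀ l₀ : Vec n), x₀ ≠ 0 → l₀ ≠ 0 →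
  ∀ A₁ A₂ (x₁ x₂ l₁ l₂ : ℝ → Vec n),
    IsSolutionWith M A₁ x₁ → IsSolutionWith M A₂ x₂ →
    IsAdjointWith A₁ l₁ → IsAdjointWith A₂ l₂ →
    x₁ 0 = x₀ → x₂ 0 = x₀ → l₁ 0 = l₀ → l₂ 0 = l₀ →
    MaxCondWith M A₁ x₁ l₁ → MaxCondWith M A₂ x₂ l₂ →
    ∀ t ≥ (0:ℝ), x₁ t = x₂ t ∧ l₁ t = l₂ t

def omegaLimitSet {n : ℕ} (x : ℝ → Vec n) : Set (Vec n) :=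
  {p | ∃ tk : ℕ → ℝ, Tendsto tk atTop atTop ∧ Tendsto (fun k => x (tk k)) atTop (𝓝 p)}

def BNormE {n : ℕ} (M : Set (Matrix (Fin n) (Fin n) ℝ)) (y : Vec n) : EReal :=
  sSup {r : EReal | ∃ x, IsSolution M x ∧ x 0 = y ∧
      r = limsup (fun t => ((‖x t‖ : ℝ) : EReal)) atTop}

section SwitchedSystems

variable {E : Type*} [NormedAddCommGroup E] [NormedSpace ℝ E]

theorem le_mul_exp_of_le_integral {f : ℝ → ℝ} {a L T : ℝ} (hL : 0 ≤ L) (hT : 0 ≤ T)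
    (hf : ContinuousOn f (Set.Icc 0 T))
    (h : ∀ t ∈ Set.Icc 0 T, f t ≤ a + L * ∫ s in (0:ℝ)..t, f s) :
    f T ≤ a * Real.exp (L * T) := by
  set g : ℝ → ℝ := Set.IccExtend hT ((Set.Icc 0 T).domRestrict f) with hg
  have hgc : Continuous g := hf.domRestrict.Icc_extend'
  have hgf : ∀ t ∈ Set.Icc 0 T, g t = f t := fun t ht => by
    rw [hg, Set.IccExtend_of_mem hT _ ht, Set.domRestrict_apply]
  have hintegral : ∀ t ∈ Set.Icc 0 T, ∫ s in (0:ℝ)..t, g s = ∫ s in (0:ℝ)..t, f s := fun t ht => by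
    refine intervalIntegral.integral_congr fun s hs => hgf s ?_
    rw [Set.uIcc_of_le ht.1] at hs
    exact ⟨hs.1, hs.2.trans ht.2⟩
  have hd : ∀ t, HasDerivAt (fun t => a + L * ∫ s in (0:ℝ)..t, g s) (L * g t) t := fun t =>
    ((intervalIntegral.integral_hasDerivAt_right (hgc.intervalIntegrable _ _)
      (hgc.stronglyMeasurableAtFilter _ _) hgc.continuousAt).const_mul L).const_add a
  have key := le_gronwallBound_of_liminf_deriv_right_le (δ := a) (K := L) (ε := 0) (a := 0) (b := T)
    (f := fun t => a + L * ∫ s in (0:ℝ)..t, g s) (f' := fun t => L * g t)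
    (fun t _ => (hd t).continuousAt.continuousWithinAt)
    (fun t _ r hr => (hd t).hasDerivWithinAt.liminf_right_slope_le hr) (by simp)
    (fun t ht => by
      have ht' := Set.Ico_subset_Icc_self ht
      rw [add_zero, hgf t ht', hintegral t ht']
      exact mul_le_mul_of_nonneg_left (h t ht') hL) T ⟨hT, le_rfl⟩
  rw [sub_zero, gronwallBound_ε0] at key
  have hT' : T ∈ Set.Icc 0 T := ⟨hT, le_rfl⟩
  simp only [hintegral T hT'] at key
  exact (h T hT').trans key


/-- `x` solves the linear switched system with switching signal `A` taking values in `K`. -/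
structure SwitchedSolution (K : Set (E →L[ℝ] E)) (A : ℝ → E →L[ℝ] E) (x : ℝ → E) : Prop where
  meas : StronglyMeasurable A
  mem : ∀ t, A t ∈ K
  cont : ContinuousOn x (Set.Ici 0)
  eq : ∀ t ≥ (0:ℝ), x t = x 0 + ∫ s in (0:ℝ)..t, A s (x s)

theorem Continuous.intervalIntegrable_apply_of_bounded {A : ℝ → E →L[ℝ] E} {x : ℝ → E} {L : ℝ}
    (hx : Continuous x) (hA : StronglyMeasurable A) (hL : ∀ t, ‖A t‖ ≤ L) (a b : ℝ) :
    IntervalIntegrable (fun s => A s (x s)) volume a b := by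
  refine IntervalIntegrable.mono_fun' (g := fun s => L * ‖x s‖)
    (Continuous.intervalIntegrable (by fun_prop) _ _) ?_
    (Eventually.of_forall fun s => (A s).le_of_opNorm_le (hL s) _)
  have hs : StronglyMeasurable fun s => A s (x s) :=
    isBoundedBilinearMap_apply.continuous.comp_stronglyMeasurable
      (hA.prodMk hx.stronglyMeasurable)
  exact hs.aestronglyMeasurable

theorem ContinuousOn.intervalIntegrable_apply_of_bounded {A : ℝ → E →L[ℝ] E} {x : ℝ → E} {L : ℝ}
    (hx : ContinuousOn x (Set.Ici 0)) (hA : StronglyMeasurable A) (hL : ∀ t, ‖A t‖ ≤ L)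
    {a b : ℝ} (ha : 0 ≤ a) (hb : 0 ≤ b) :
    IntervalIntegrable (fun s => A s (x s)) volume a b := by
  have hyc : Continuous fun t => x (max t 0) :=
    hx.comp_continuous (by fun_prop) (fun t => Set.mem_Ici.2 (le_max_right _ _))
  refine (hyc.intervalIntegrable_apply_of_bounded hA hL a b).congr fun s hs => ?_
  have : 0 ≤ s := (le_min ha hb).trans hs.1.le
  simp [max_eq_left this]

namespace SwitchedSolution

variable {K : Set (E →L[ℝ] E)} {A : ℝ → E →L[ℝ] E} {x y : ℝ → E} {L : ℝ}

theorem intervalIntegrable (h : SwitchedSolution K A x) (hL : ∀ B ∈ K, ‖B‖ ≤ L) {a b : ℝ}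
    (ha : 0 ≤ a) (hb : 0 ≤ b) : IntervalIntegrable (fun s => A s (x s)) volume a b :=
  h.cont.intervalIntegrable_apply_of_bounded h.meas (fun t => hL _ (h.mem t)) ha hb

theorem sub_eq (h : SwitchedSolution K A x) (hL : ∀ B ∈ K, ‖B‖ ≤ L) {a b : ℝ}
    (ha : 0 ≤ a) (hb : 0 ≤ b) : x b - x a = ∫ s in a..b, A s (x s) := by
  rw [h.eq b hb, h.eq a ha, add_sub_add_left_eq_sub,
    intervalIntegral.integral_interval_sub_left (h.intervalIntegrable hL le_rfl hb)
      (h.intervalIntegrable hL le_rfl ha)]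

theorem add (hx : SwitchedSolution K A x) (hy : SwitchedSolution K A y)
    (hL : ∀ B ∈ K, ‖B‖ ≤ L) : SwitchedSolution K A (fun t => x t + y t) := by
  refine ⟨hx.meas, hx.mem, hx.cont.add hy.cont, fun t ht => ?_⟩
  simp only [map_add]
  rw [intervalIntegral.integral_add (hx.intervalIntegrable hL le_rfl ht)
    (hy.intervalIntegrable hL le_rfl ht), hx.eq t ht, hy.eq t ht]
  abel

theorem smul (hx : SwitchedSolution K A x) (c : ℝ) :
    SwitchedSolution K A (fun t => c • x t) := by
  refine ⟨hx.meas, hx.mem, hx.cont.const_smul c, fun t ht => ?_⟩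
  simp only [map_smul]
  rw [intervalIntegral.integral_smul, hx.eq t ht, smul_add]

theorem sub (hx : SwitchedSolution K A x) (hy : SwitchedSolution K A y)
    (hL : ∀ B ∈ K, ‖B‖ ≤ L) : SwitchedSolution K A (fun t => x t - y t) := by
  simpa [sub_eq_add_neg] using hx.add (hy.smul (-1)) hL

theorem shift (h : SwitchedSolution K A x) (hL : ∀ B ∈ K, ‖B‖ ≤ L) {T : ℝ} (hT : 0 ≤ T) :
    SwitchedSolution K (fun t => A (t + T)) (fun t => x (t + T)) := by
  refine ⟨h.meas.comp_measurable (measurable_id.add_const T), fun t => h.mem _,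
    h.cont.comp (by fun_prop) fun t ht => add_nonneg ht hT, fun t ht => ?_⟩
  have := h.sub_eq hL hT (add_nonneg ht hT)
  rw [intervalIntegral.integral_comp_add_right (fun s => A s (x s)), zero_add, ← this]
  abel

theorem concat {B : ℝ → E →L[ℝ] E} (hx : SwitchedSolution K A x) (hy : SwitchedSolution K B y)
    (hL : ∀ B ∈ K, ‖B‖ ≤ L) {T : ℝ} (hT : 0 ≤ T) (h0 : y 0 = x T) :
    SwitchedSolution K (fun t => if t ≤ T then A t else B (t - T))
      (fun t => if t ≤ T then x t else y (t - T)) := by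
  have hm : StronglyMeasurable (fun t => if t ≤ T then A t else B (t - T)) :=
    StronglyMeasurable.ite measurableSet_Iic hx.meas
      (hy.meas.comp_measurable (measurable_id.sub_const T))
  have hmem : ∀ t, (if t ≤ T then A t else B (t - T)) ∈ K := fun t => by
    split_ifs
    exacts [hx.mem _, hy.mem _]
  have hc : ContinuousOn (fun t => if t ≤ T then x t else y (t - T)) (Set.Ici 0) := by
    have hX : Continuous fun t => x (max t 0) :=
      hx.cont.comp_continuous (by fun_prop) (fun t => Set.mem_Ici.2 (le_max_right _ _))
    have hY : Continuous fun t => y (max (t - T) 0) :=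
      hy.cont.comp_continuous (by fun_prop) (fun t => Set.mem_Ici.2 (le_max_right _ _))
    have : Continuous fun t => if t ≤ T then x (max t 0) else y (max (t - T) 0) := by
      refine Continuous.if_le hX hY continuous_id continuous_const ?_
      rintro t rfl
      simp [h0, max_eq_left hT]
    refine this.continuousOn.congr fun t ht => ?_
    dsimp only
    split_ifs with h
    · rw [max_eq_left ht]
    · rw [max_eq_left (by linarith)]
  refine ⟨hm, hmem, hc, fun t ht => ?_⟩
  have hcong : ∀ t, 0 ≤ t → t ≤ T →
      ∫ s in (0:ℝ)..t, (if s ≤ T then A s else B (s - T)) (if s ≤ T then x s else y (s - T))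
        = ∫ s in (0:ℝ)..t, A s (x s) := fun t ht htT => by
    refine intervalIntegral.integral_congr fun s hs => ?_
    rw [Set.uIcc_of_le ht] at hs
    simp [hs.2.trans htT]
  simp only [if_pos hT]
  by_cases htT : t ≤ T
  · rw [hcong t ht htT, if_pos htT, hx.eq t ht]
  · have htT' : T ≤ t := (not_le.1 htT).le
    have hi : ∀ a b : ℝ, 0 ≤ a → 0 ≤ b → IntervalIntegrable
        (fun s => (if s ≤ T then A s else B (s - T)) (if s ≤ T then x s else y (s - T)))
        volume a b := fun a b ha hb =>
      hc.intervalIntegrable_apply_of_bounded hm (fun t => hL _ (hmem t)) ha hb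
    rw [if_neg htT, ← intervalIntegral.integral_add_adjacent_intervals (hi 0 T le_rfl hT)
      (hi T t hT ht), hcong T hT le_rfl, ← add_assoc, ← hx.eq T hT, ← h0, hy.eq (t - T) (by linarith)]
    congr 1
    have h2 := intervalIntegral.integral_comp_sub_right (fun s => B s (y s)) (a := T) (b := t) T
    rw [sub_self] at h2
    rw [← h2]
    refine intervalIntegral.integral_congr_ae ?_
    refine Eventually.of_forall fun s hs => ?_
    rw [Set.uIoc_of_le htT'] at hs
    simp [not_le.2 hs.1]

theorem continuousOn_norm (h : SwitchedSolution K A x) :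
    ContinuousOn (fun t => ‖x t‖) (Set.Ici 0) := h.cont.norm

theorem norm_sub_le_integral (h : SwitchedSolution K A x) (hL : ∀ B ∈ K, ‖B‖ ≤ L) {a b : ℝ}
    (ha : 0 ≤ a) (hab : a ≤ b) : ‖x b - x a‖ ≤ L * ∫ s in a..b, ‖x s‖ := by
  rw [h.sub_eq hL ha (ha.trans hab), ← intervalIntegral.integral_const_mul]
  refine intervalIntegral.norm_integral_le_of_norm_le hab
    (Eventually.of_forall fun s _ => (A s).le_of_opNorm_le (hL _ (h.mem s)) _) ?_
  refine ContinuousOn.intervalIntegrable ?_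
  rw [Set.uIcc_of_le hab]
  exact (h.continuousOn_norm.mono fun s hs => ha.trans hs.1).const_smul L

theorem norm_le (h : SwitchedSolution K A x) (hL : ∀ B ∈ K, ‖B‖ ≤ L) (hL0 : 0 ≤ L) {t : ℝ}
    (ht : 0 ≤ t) : ‖x t‖ ≤ ‖x 0‖ * Real.exp (L * t) := by
  refine le_mul_exp_of_le_integral hL0 ht (h.continuousOn_norm.mono fun s hs => hs.1)
    fun s hs => ?_
  have h1 := h.norm_sub_le_integral hL le_rfl hs.1
  have h2 := norm_le_norm_add_norm_sub (x 0) (x s)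
  rw [norm_sub_rev] at h2
  linarith

theorem norm_zero_le (h : SwitchedSolution K A x) (hL : ∀ B ∈ K, ‖B‖ ≤ L) (hL0 : 0 ≤ L) {t : ℝ}
    (ht : 0 ≤ t) : ‖x 0‖ ≤ ‖x t‖ * Real.exp (L * t) := by
  have := le_mul_exp_of_le_integral (f := fun r => ‖x (t - r)‖) (a := ‖x t‖) hL0 ht
    (h.continuousOn_norm.comp (by fun_prop) fun s hs => sub_nonneg.2 hs.2) fun r hr => by
      have h1 := h.norm_sub_le_integral hL (sub_nonneg.2 hr.2) (sub_le_self t hr.1)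
      have h2 := norm_le_norm_add_norm_sub (x t) (x (t - r))
      have h3 := intervalIntegral.integral_comp_sub_left (fun s => ‖x s‖) (a := 0) (b := r) t
      rw [sub_zero] at h3
      rw [h3]
      linarith
  simpa using this

end SwitchedSolution

theorem norm_integral_apply_le_exp {A : ℝ → E →L[ℝ] E} {u : ℝ → E} {L c t : ℝ} (hL0 : 0 < L)
    (hL : ∀ t, ‖A t‖ ≤ L) (hu : ∀ s, ‖u s‖ ≤ c * Real.exp (2 * L * s)) (hc : 0 ≤ c) (ht : 0 ≤ t) :
    ‖∫ s in (0:ℝ)..t, A s (u s)‖ ≤ c / 2 * Real.exp (2 * L * t) := by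
  have h1 : ‖∫ s in (0:ℝ)..t, A s (u s)‖ ≤ ∫ s in (0:ℝ)..t, L * (c * Real.exp (2 * L * s)) := by
    refine intervalIntegral.norm_integral_le_of_norm_le ht (Eventually.of_forall fun s _ => ?_)
      (Continuous.intervalIntegrable (by fun_prop) _ _)
    exact ((A s).le_of_opNorm_le (hL s) _).trans (mul_le_mul_of_nonneg_left (hu s) hL0.le)
  refine h1.trans ?_
  have hd : ∀ s ∈ Set.uIcc 0 t, HasDerivAt (fun s => c / 2 * Real.exp (2 * L * s))
      (L * (c * Real.exp (2 * L * s))) s := fun s _ => by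
    have := ((hasDerivAt_id s).const_mul (2 * L)).exp.const_mul (c / 2)
    refine this.congr_deriv ?_
    simp only [id]
    ring
  rw [intervalIntegral.integral_eq_sub_of_hasDerivAt hd
    (Continuous.intervalIntegrable (by fun_prop) _ _)]
  simp only [mul_zero, Real.exp_zero, mul_one]
  linarith

open BoundedContinuousFunction in
theorem SwitchedSolution.exists_of_signal [CompleteSpace E] {K : Set (E →L[ℝ] E)}
    {A : ℝ → E →L[ℝ] E} {L : ℝ} (hA : StronglyMeasurable A) (hmem : ∀ t, A t ∈ K)
    (hK : ∀ B ∈ K, ‖B‖ ≤ L) (hL0 : 0 < L) (y : E) :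
    ∃ x, SwitchedSolution K A x ∧ x 0 = y := by
  have hL : ∀ t, ‖A t‖ ≤ L := fun t => hK _ (hmem t)
  let w : (ℝ →ᵇ E) → ℝ → E := fun z s => Real.exp (2 * L * s) • z s
  have hwc : ∀ z, Continuous (w z) := fun z =>
    (Continuous.rexp (by fun_prop)).smul z.continuous
  have hwi : ∀ z a b, IntervalIntegrable (fun s => A s (w z s)) volume a b := fun z a b =>
    (hwc z).intervalIntegrable_apply_of_bounded hA hL a b
  have hexp : ∀ t : ℝ, Real.exp (-(2 * L * t)) * Real.exp (2 * L * t) = 1 := fun t => by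
    rw [← Real.exp_add, neg_add_cancel, Real.exp_zero]
  have hintegral : ∀ (z : ℝ → E) (c t : ℝ), 0 ≤ c → (∀ s, ‖z s‖ ≤ c) → 0 ≤ t →
      ‖Real.exp (-(2 * L * t)) • ∫ s in (0:ℝ)..t, A s (Real.exp (2 * L * s) • z s)‖ ≤ c / 2 := by
    intro z c t hc hz ht
    have := norm_integral_apply_le_exp (A := A) (u := fun s => Real.exp (2 * L * s) • z s)
      hL0 hL (fun s => by
        rw [norm_smul, Real.norm_eq_abs, Real.abs_exp, mul_comm]
        exact mul_le_mul_of_nonneg_right (hz s) (Real.exp_pos _).le) hc ht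
    rw [norm_smul, Real.norm_eq_abs, Real.abs_exp]
    calc _ ≤ Real.exp (-(2 * L * t)) * (c / 2 * Real.exp (2 * L * t)) :=
          mul_le_mul_of_nonneg_left this (Real.exp_pos _).le
      _ = c / 2 * (Real.exp (-(2 * L * t)) * Real.exp (2 * L * t)) := by ring
      _ = c / 2 := by rw [hexp, mul_one]
  let F : (ℝ →ᵇ E) → ℝ → E := fun z t =>
    Real.exp (-(2 * L * max t 0)) • (y + ∫ s in (0:ℝ)..max t 0, A s (w z s))
  have hFc : ∀ z, Continuous (F z) := fun z => by
    have h1 : Continuous fun t => ∫ s in (0:ℝ)..t, A s (w z s) :=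
      intervalIntegral.continuous_primitive (hwi z) 0
    exact (Continuous.rexp (by fun_prop)).smul
      (continuous_const.add (h1.comp (continuous_id.max continuous_const)))
  have hFb : ∀ z t, ‖F z t‖ ≤ ‖y‖ + ‖z‖ / 2 := fun z t => by
    have ht : 0 ≤ max t 0 := le_max_right _ _
    simp only [F, smul_add]
    refine (norm_add_le _ _).trans (add_le_add ?_
      (hintegral z ‖z‖ _ (norm_nonneg _) z.norm_coe_le_norm ht))
    rw [norm_smul, Real.norm_eq_abs, Real.abs_exp]
    refine mul_le_of_le_one_left (norm_nonneg _) (Real.exp_le_one_iff.2 ?_)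
    have := mul_nonneg (mul_nonneg zero_le_two hL0.le) ht
    linarith
  let Φ : (ℝ →ᵇ E) → (ℝ →ᵇ E) := fun z =>
    BoundedContinuousFunction.ofNormedAddCommGroup (F z) (hFc z) _ (hFb z)
  have hΦ : ContractingWith (1 / 2) Φ := by
    refine ⟨by norm_num [← NNReal.coe_lt_coe], LipschitzWith.of_dist_le_mul fun z₁ z₂ => ?_⟩
    refine (BoundedContinuousFunction.dist_le (by positivity)).2 fun t => ?_
    have := hintegral (fun s => z₁ s - z₂ s) (dist z₁ z₂) (max t 0) dist_nonneg
      (fun s => by rw [← dist_eq_norm]; exact BoundedContinuousFunction.dist_coe_le_dist s)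
      (le_max_right _ _)
    have heq : F z₁ t - F z₂ t = Real.exp (-(2 * L * max t 0)) •
        ∫ s in (0:ℝ)..max t 0, A s (Real.exp (2 * L * s) • (z₁ s - z₂ s)) := by
      simp only [F, ← smul_sub, add_sub_add_left_eq_sub]
      rw [← intervalIntegral.integral_sub (hwi z₁ _ _) (hwi z₂ _ _)]
      simp only [w, ← map_sub, ← smul_sub]
    change dist (F z₁ t) (F z₂ t) ≤ _
    rw [dist_eq_norm, heq]
    refine this.trans (le_of_eq ?_)
    push_cast
    ring
  obtain ⟨z, hz⟩ : ∃ z, Φ z = z := ⟨_, hΦ.fixedPoint_isFixedPt⟩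
  have hzt : ∀ t, F z t = z t := fun t => congrArg (fun f : ℝ →ᵇ E => f t) hz
  have hw : ∀ t ≥ (0:ℝ), w z t = y + ∫ s in (0:ℝ)..t, A s (w z s) := fun t ht => by
    simp only [w]
    rw [← hzt t]
    simp only [F, max_eq_left ht]
    rw [smul_smul, mul_comm, hexp, one_smul]
  have hw0 : w z 0 = y := by simpa using hw 0 le_rfl
  exact ⟨w z, ⟨hA, hmem, (hwc z).continuousOn, fun t ht => by rw [hw0]; exact hw t ht⟩, hw0⟩

theorem Ultrafilter.exists_tendsto_of_norm_le {ι F : Type*} [NormedAddCommGroup F] [ProperSpace F]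
    (𝒰 : Ultrafilter ι) {f : ι → F} {c : ℝ} (hf : ∀ k, ‖f k‖ ≤ c) :
    ∃ z, Tendsto f 𝒰 (𝓝 z) := by
  obtain ⟨z, -, hz⟩ := (isCompact_closedBall (0 : F) c).ultrafilter_le_nhds (𝒰.map f) (by
    rw [le_principal_iff]
    exact mem_map.2 (Eventually.of_forall fun k => by simpa using hf k))
  exact ⟨z, hz⟩

theorem StronglyMeasurable.intervalIntegrable_of_norm_le {F : Type*} [NormedAddCommGroup F]
    {A : ℝ → F} {L : ℝ}
    (hA : StronglyMeasurable A) (hL : ∀ t, ‖A t‖ ≤ L) (a b : ℝ) :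
    IntervalIntegrable A volume a b :=
  IntervalIntegrable.mono_fun' (g := fun _ => L) intervalIntegrable_const
    hA.aestronglyMeasurable (Eventually.of_forall hL)

theorem Convex.inv_smul_intervalIntegral_mem [CompleteSpace E] {K : Set E} (hK : Convex ℝ K)
    (hKc : IsClosed K) {A : ℝ → E} (hA : ∀ t, A t ∈ K) {a b : ℝ} (hab : a < b)
    (hi : IntervalIntegrable A volume a b) : (b - a)⁻¹ • ∫ s in a..b, A s ∈ K := by
  rw [← interval_average_eq]
  refine hK.set_average_mem hKc ?_ ?_ (Eventually.of_forall hA) hi.def'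
  · simp [Set.uIoc_of_le hab.le, hab]
  · simp [Set.uIoc_of_le hab.le]

theorem HasDerivAt.of_linearization {P : ℝ → E →L[ℝ] E} {B : E →L[ℝ] E} {z : ℝ → E} {t C : ℝ}
    (hP : HasDerivAt P B t)
    (hz : ∀ᶠ r in 𝓝 t, ‖z r - z t - (P r - P t) (z t)‖ ≤ C * |r - t| ^ 2) :
    HasDerivAt z (B (z t)) t := by
  have hPz : HasDerivAt (fun r => P r (z t)) (B (z t)) t := by
    simpa using hP.clm_apply (hasDerivAt_const t (z t))
  have herr : HasDerivAt (fun r => z r - P r (z t)) 0 t := by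
    rw [hasDerivAt_iff_isLittleO]
    have hO : (fun r => z r - P r (z t) - (z t - P t (z t)) - (r - t) • (0 : E))
        =O[𝓝 t] fun r => (r - t) ^ 2 := by
      refine Asymptotics.IsBigO.of_bound C ?_
      filter_upwards [hz] with r hr
      have e : z r - P r (z t) - (z t - P t (z t)) - (r - t) • (0 : E)
          = z r - z t - (P r - P t) (z t) := by
        rw [smul_zero, _root_.sub_apply]
        abel
      rwa [e, norm_pow, Real.norm_eq_abs]
    have hsub : Tendsto (fun r => r - t) (𝓝 t) (𝓝 0) := by
      simpa using (continuous_sub_right t).tendsto t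
    exact hO.trans_isLittleO
      ((Asymptotics.isLittleO_pow_id (𝕜 := ℝ) one_lt_two).comp_tendsto hsub)
  refine ((herr.add hPz).congr_deriv (zero_add _)).congr_of_eventuallyEq
    (Eventually.of_forall fun r => ?_)
  simp

theorem LipschitzOnWith.eq_add_integral_of_ae_hasDerivAt [CompleteSpace E] {z g : ℝ → E}
    {C : NNReal} {D T : ℝ} (hT : 0 ≤ T) (hz : LipschitzOnWith C z (Set.Icc 0 T))
    (hg : ∀ {a b : ℝ}, 0 ≤ a → 0 ≤ b → IntervalIntegrable g volume a b)
    (hD : ∀ t ∈ Set.Icc 0 T, ‖g t‖ ≤ D)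
    (hd : ∀ᵐ t, t ∈ Set.Icc 0 T → 0 < t → HasDerivAt z (g t) t) :
    z T = z 0 + ∫ s in (0:ℝ)..T, g s := by
  have hIL : LipschitzOnWith (Real.toNNReal D) (fun t => ∫ s in (0:ℝ)..t, g s) (Set.Icc 0 T) :=
    LipschitzOnWith.of_dist_le_mul fun a ha b hb => by
      rw [dist_eq_norm, Real.dist_eq, intervalIntegral.integral_interval_sub_left
        (hg le_rfl ha.1) (hg le_rfl hb.1)]
      refine (intervalIntegral.norm_integral_le_of_norm_le_const fun s hs => ?_).trans
        (mul_le_mul_of_nonneg_right (Real.le_coe_toNNReal _) (abs_nonneg _))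
      exact hD s (Set.uIcc_subset_Icc hb ha (Set.uIoc_subset_uIcc hs))
  rw [← Set.uIcc_of_le hT] at hz hIL hd
  obtain ⟨c, hc⟩ := (hz.absolutelyContinuousOnInterval.sub
    hIL.absolutelyContinuousOnInterval).const_of_ae_hasDerivAt_zero (by
      have h0 : ∀ᵐ t : ℝ, t ≠ 0 := by simp [ae_iff, measure_singleton]
      filter_upwards [hd, (hg le_rfl hT).ae_hasDerivAt_integral, h0] with t htz htI ht0 htm
      have hI := htI htm 0 Set.left_mem_uIcc
      have htpos : 0 < t := by
        rw [Set.uIcc_of_le hT] at htm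
        exact lt_of_le_of_ne htm.1 (Ne.symm ht0)
      exact ((htz htm htpos).sub hI).congr_deriv (sub_self _))
  have e0 := hc 0 Set.left_mem_uIcc
  have eT := hc T Set.right_mem_uIcc
  simp only [Pi.sub_apply, intervalIntegral.integral_same, sub_zero] at e0 eT
  rw [e0, ← eT, sub_add_cancel]

namespace SwitchedSolution

variable {K : Set (E →L[ℝ] E)} {A : ℝ → E →L[ℝ] E} {x : ℝ → E} {L : ℝ}

theorem norm_le_of_mem_Icc (h : SwitchedSolution K A x) (hL : ∀ B ∈ K, ‖B‖ ≤ L) (hL0 : 0 ≤ L)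
    {t T : ℝ} (ht : t ∈ Set.Icc 0 T) : ‖x t‖ ≤ ‖x 0‖ * Real.exp (L * T) := by
  refine (h.norm_le hL hL0 ht.1).trans (mul_le_mul_of_nonneg_left ?_ (norm_nonneg _))
  exact Real.exp_le_exp.2 (mul_le_mul_of_nonneg_left ht.2 hL0)

theorem norm_sub_le (h : SwitchedSolution K A x) (hL : ∀ B ∈ K, ‖B‖ ≤ L) (hL0 : 0 ≤ L)
    {a b T : ℝ} (ha : a ∈ Set.Icc 0 T) (hb : b ∈ Set.Icc 0 T) :
    ‖x b - x a‖ ≤ L * (‖x 0‖ * Real.exp (L * T)) * |b - a| := by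
  rw [h.sub_eq hL ha.1 hb.1]
  refine intervalIntegral.norm_integral_le_of_norm_le_const fun s hs => ?_
  refine (A s).le_of_opNorm_le_of_le (hL _ (h.mem s)) (h.norm_le_of_mem_Icc hL hL0 ?_)
  exact Set.uIcc_subset_Icc ha hb (Set.uIoc_subset_uIcc hs)

theorem norm_sub_sub_le [CompleteSpace E] (h : SwitchedSolution K A x) (hL : ∀ B ∈ K, ‖B‖ ≤ L)
    (hL0 : 0 ≤ L) {a b T : ℝ} (ha : a ∈ Set.Icc 0 T) (hb : b ∈ Set.Icc 0 T) :
    ‖x b - x a - (∫ s in a..b, A s) (x a)‖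
      ≤ L * (L * (‖x 0‖ * Real.exp (L * T)) * |b - a|) * |b - a| := by
  have hAi := StronglyMeasurable.intervalIntegrable_of_norm_le h.meas (fun t => hL _ (h.mem t)) a b
  rw [h.sub_eq hL ha.1 hb.1, ContinuousLinearMap.intervalIntegral_apply hAi,
    ← intervalIntegral.integral_sub (h.intervalIntegrable hL ha.1 hb.1)
      (continuous_const.intervalIntegrable_apply_of_bounded h.meas (fun t => hL _ (h.mem t)) _ _)]
  refine intervalIntegral.norm_integral_le_of_norm_le_const fun s hs => ?_
  rw [← map_sub]
  have hs' := Set.uIoc_subset_uIcc hs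
  refine (A s).le_of_opNorm_le_of_le (hL _ (h.mem s))
    ((h.norm_sub_le hL hL0 ha (Set.uIcc_subset_Icc ha hb hs')).trans ?_)
  refine mul_le_mul_of_nonneg_left (Set.abs_sub_left_of_mem_uIcc hs') (by positivity)

/-- A curve which is, up to a quadratic error, driven by the increments of a Lipschitz path `P`
with slopes in `K` solves the switched system. -/
theorem exists_signal_of_linearization [FiniteDimensional ℝ E] (hKc : IsClosed K)
    (hL : ∀ B ∈ K, ‖B‖ ≤ L) {P : ℝ → E →L[ℝ] E} {z : ℝ → E} {R : ℝ}
    (hPL : LipschitzWith (Real.toNNReal L) P)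
    (hPK : ∀ a b, a < b → (b - a)⁻¹ • (P b - P a) ∈ K)
    (hbound : ∀ {t T : ℝ}, t ∈ Set.Icc 0 T → ‖z t‖ ≤ R * Real.exp (L * T))
    (hlip : ∀ {a b T : ℝ}, a ∈ Set.Icc 0 T → b ∈ Set.Icc 0 T →
      ‖z b - z a‖ ≤ L * (R * Real.exp (L * T)) * |b - a|)
    (hlin : ∀ {a b T : ℝ}, a ∈ Set.Icc 0 T → b ∈ Set.Icc 0 T →
      ‖z b - z a - (P b - P a) (z a)‖ ≤ L * (L * (R * Real.exp (L * T)) * |b - a|) * |b - a|) :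
    ∃ B, SwitchedSolution K B z := by
  have : CompleteSpace E := FiniteDimensional.complete ℝ E
  have hPd : ∀ᵐ t, DifferentiableAt ℝ P t := hPL.ae_differentiableAt_real
  classical
  set B : ℝ → E →L[ℝ] E := fun t => if DifferentiableAt ℝ P t then deriv P t else
    ((1:ℝ) - 0)⁻¹ • (P 1 - P 0) with hB
  have hBm : StronglyMeasurable B :=
    StronglyMeasurable.ite (measurableSet_of_differentiableAt ℝ P) (stronglyMeasurable_deriv P)
      stronglyMeasurable_const
  have hBK : ∀ t, B t ∈ K := fun t => by
    simp only [hB]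
    split_ifs with hd
    · refine hKc.mem_of_tendsto hd.hasDerivAt.tendsto_slope_zero_right ?_
      filter_upwards [self_mem_nhdsWithin] with r hr
      have := hPK t (t + r) (lt_add_of_pos_right t hr)
      rwa [add_sub_cancel_left] at this
    · exact hPK 0 1 one_pos
  have hBL : ∀ t, ‖B t‖ ≤ L := fun t => hL _ (hBK t)
  have hzL : ∀ T, LipschitzOnWith (Real.toNNReal (L * (R * Real.exp (L * T)))) z (Set.Icc 0 T) :=
    fun T => LipschitzOnWith.of_dist_le_mul fun a ha b hb => by
      rw [dist_eq_norm, Real.dist_eq]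
      exact (hlip hb ha).trans (mul_le_mul_of_nonneg_right (Real.le_coe_toNNReal _) (abs_nonneg _))
  have hzc : ContinuousOn z (Set.Ici 0) := fun t ht =>
    ((hzL (t + 1)).continuousOn t ⟨ht, by linarith⟩).mono_of_mem_nhdsWithin
      (inter_mem_nhdsWithin _ (Iic_mem_nhds (lt_add_one t)))
  have hBi : ∀ {a b : ℝ}, 0 ≤ a → 0 ≤ b → IntervalIntegrable (fun s => B s (z s)) volume a b :=
    fun ha hb => hzc.intervalIntegrable_apply_of_bounded hBm hBL ha hb
  refine ⟨B, hBm, hBK, hzc, fun T hT => ?_⟩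
  refine (hzL T).eq_add_integral_of_ae_hasDerivAt (D := L * (R * Real.exp (L * T))) hT hBi
    (fun t ht => (B t).le_of_opNorm_le_of_le (hBL t) (hbound ht)) ?_
  filter_upwards [hPd] with t htP htm htpos
  have hPt : HasDerivAt P (B t) t := by
    simp only [hB, if_pos htP]
    exact htP.hasDerivAt
  refine hPt.of_linearization (C := L * (L * (R * Real.exp (L * (t + 1))))) ?_
  filter_upwards [Ioo_mem_nhds htpos (lt_add_one t)] with r hr
  refine (hlin (T := t + 1) (a := t) (b := r) ⟨htpos.le, by linarith⟩
    ⟨hr.1.le, hr.2.le⟩).trans (le_of_eq (by ring))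

theorem exists_tendsto_ultrafilter [FiniteDimensional ℝ E] {ι : Type*} (𝒰 : Ultrafilter ι)
    (hKc : IsClosed K) (hKconv : Convex ℝ K) (hL : ∀ B ∈ K, ‖B‖ ≤ L) (hL0 : 0 ≤ L)
    {A : ι → ℝ → E →L[ℝ] E} {x : ι → ℝ → E} (h : ∀ k, SwitchedSolution K (A k) (x k)) {R : ℝ}
    (hR : ∀ k, ‖x k 0‖ ≤ R) :
    ∃ B z, SwitchedSolution K B z ∧ ∀ t ≥ (0:ℝ), Tendsto (fun k => x k t) 𝒰 (𝓝 (z t)) := by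
  have : ProperSpace E := FiniteDimensional.proper_real E
  have : ProperSpace (E →L[ℝ] E) := FiniteDimensional.proper_real _
  have : CompleteSpace E := FiniteDimensional.complete ℝ E
  have hAi : ∀ k a b, IntervalIntegrable (A k) volume a b := fun k a b =>
    StronglyMeasurable.intervalIntegrable_of_norm_le (h k).meas (fun t => hL _ ((h k).mem t)) a b
  have hP : ∀ t, ∃ p, Tendsto (fun k => ∫ s in (0:ℝ)..t, A k s) 𝒰 (𝓝 p) := fun t =>
    𝒰.exists_tendsto_of_norm_le fun k =>
      intervalIntegral.norm_integral_le_of_norm_le_const fun s _ => hL _ ((h k).mem s)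
  choose P hP using hP
  have hPi : ∀ a b, Tendsto (fun k => ∫ s in a..b, A k s) 𝒰 (𝓝 (P b - P a)) := fun a b =>
    ((hP b).sub (hP a)).congr fun k =>
      intervalIntegral.integral_interval_sub_left (hAi k _ _) (hAi k _ _)
  have hZ : ∀ t, ∃ p, Tendsto (fun k => x k (max t 0)) 𝒰 (𝓝 p) := fun t =>
    𝒰.exists_tendsto_of_norm_le (c := R * Real.exp (L * max t 0)) fun k =>
      ((h k).norm_le hL hL0 (le_max_right _ _)).trans
        (mul_le_mul_of_nonneg_right (hR k) (Real.exp_pos _).le)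
  choose z hz using hZ
  replace hz : ∀ t ≥ (0:ℝ), Tendsto (fun k => x k t) 𝒰 (𝓝 (z t)) := fun t ht => by
    simpa [max_eq_left ht] using hz t
  have hPL : LipschitzWith (Real.toNNReal L) P := by
    refine LipschitzWith.of_dist_le_mul fun a b => ?_
    rw [dist_eq_norm, Real.coe_toNNReal _ hL0, Real.dist_eq]
    exact le_of_tendsto (hPi b a).norm (Eventually.of_forall fun k =>
      intervalIntegral.norm_integral_le_of_norm_le_const fun s _ => hL _ ((h k).mem s))
  have hPK : ∀ a b, a < b → (b - a)⁻¹ • (P b - P a) ∈ K := fun a b hab =>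
    hKc.mem_of_tendsto ((hPi a b).const_smul (b - a)⁻¹) (Eventually.of_forall fun k =>
      hKconv.inv_smul_intervalIntegral_mem hKc (h k).mem hab (hAi k _ _))
  have hbound : ∀ {t T : ℝ}, t ∈ Set.Icc 0 T → ‖z t‖ ≤ R * Real.exp (L * T) := fun {t T} ht =>
    le_of_tendsto (hz t ht.1).norm (Eventually.of_forall fun k =>
      ((h k).norm_le_of_mem_Icc hL hL0 ht).trans
        (mul_le_mul_of_nonneg_right (hR k) (Real.exp_pos _).le))
  have hRT : ∀ k T, L * (‖x k 0‖ * Real.exp (L * T)) ≤ L * (R * Real.exp (L * T)) := fun k T =>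
    mul_le_mul_of_nonneg_left (mul_le_mul_of_nonneg_right (hR k) (Real.exp_pos _).le) hL0
  have hlip : ∀ {a b T : ℝ}, a ∈ Set.Icc 0 T → b ∈ Set.Icc 0 T →
      ‖z b - z a‖ ≤ L * (R * Real.exp (L * T)) * |b - a| := fun {a b T} ha hb =>
    le_of_tendsto ((hz b hb.1).sub (hz a ha.1)).norm (Eventually.of_forall fun k =>
      ((h k).norm_sub_le hL hL0 ha hb).trans
        (mul_le_mul_of_nonneg_right (hRT k T) (abs_nonneg _)))
  have happ : ∀ {f : ι → E →L[ℝ] E} {g : ι → E} {p q}, Tendsto f 𝒰 (𝓝 p) → Tendsto g 𝒰 (𝓝 q) →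
      Tendsto (fun k => f k (g k)) 𝒰 (𝓝 (p q)) := fun {f g p q} hf hg =>
    (isBoundedBilinearMap_apply.continuous.tendsto (p, q)).comp (hf.prodMk_nhds hg)
  have hlin : ∀ {a b T : ℝ}, a ∈ Set.Icc 0 T → b ∈ Set.Icc 0 T →
      ‖z b - z a - (P b - P a) (z a)‖ ≤ L * (L * (R * Real.exp (L * T)) * |b - a|) * |b - a| :=
    fun {a b T} ha hb => by
      refine le_of_tendsto (((hz b hb.1).sub (hz a ha.1)).sub
        (happ (hPi a b) (hz a ha.1))).norm (Eventually.of_forall fun k =>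
        ((h k).norm_sub_sub_le hL hL0 ha hb).trans ?_)
      gcongr L * (?_ * |b - a|) * |b - a|
      exact hRT k T
  obtain ⟨B, hB⟩ := exists_signal_of_linearization hKc hL hPL hPK hbound hlip hlin
  exact ⟨B, z, hB, hz⟩

end SwitchedSolution

/-- `x` solves the linear switched system associated with `K`. -/
def IsSwitchedSolution (K : Set (E →L[ℝ] E)) (x : ℝ → E) : Prop :=
  ∃ A, SwitchedSolution K A x

namespace IsSwitchedSolution

variable {K : Set (E →L[ℝ] E)} {x y : ℝ → E} {L : ℝ}

theorem smul (h : IsSwitchedSolution K x) (c : ℝ) : IsSwitchedSolution K (fun t => c • x t) :=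
  let ⟨A, hA⟩ := h
  ⟨A, hA.smul c⟩

theorem shift (h : IsSwitchedSolution K x) (hL : ∀ B ∈ K, ‖B‖ ≤ L) {T : ℝ} (hT : 0 ≤ T) :
    IsSwitchedSolution K (fun t => x (t + T)) :=
  let ⟨_, hA⟩ := h
  ⟨_, hA.shift hL hT⟩

theorem concat (hx : IsSwitchedSolution K x) (hy : IsSwitchedSolution K y)
    (hL : ∀ B ∈ K, ‖B‖ ≤ L) {T : ℝ} (hT : 0 ≤ T) (h0 : y 0 = x T) :
    IsSwitchedSolution K (fun t => if t ≤ T then x t else y (t - T)) :=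
  let ⟨_, hA⟩ := hx
  let ⟨_, hB⟩ := hy
  ⟨_, hA.concat hB hL hT h0⟩

theorem norm_le (h : IsSwitchedSolution K x) (hL : ∀ B ∈ K, ‖B‖ ≤ L) (hL0 : 0 ≤ L) {t : ℝ}
    (ht : 0 ≤ t) : ‖x t‖ ≤ ‖x 0‖ * Real.exp (L * t) :=
  let ⟨_, hA⟩ := h
  hA.norm_le hL hL0 ht

theorem norm_zero_le (h : IsSwitchedSolution K x) (hL : ∀ B ∈ K, ‖B‖ ≤ L) (hL0 : 0 ≤ L) {t : ℝ}
    (ht : 0 ≤ t) : ‖x 0‖ ≤ ‖x t‖ * Real.exp (L * t) :=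
  let ⟨_, hA⟩ := h
  hA.norm_zero_le hL hL0 ht

theorem exists_of_initial [CompleteSpace E] (hne : K.Nonempty) (hL : ∀ B ∈ K, ‖B‖ ≤ L)
    (hL0 : 0 < L) (v : E) : ∃ x, IsSwitchedSolution K x ∧ x 0 = v := by
  obtain ⟨B, hB⟩ := hne
  obtain ⟨x, hx, hx0⟩ := SwitchedSolution.exists_of_signal (A := fun _ => B)
    stronglyMeasurable_const (fun _ => hB) hL hL0 v
  exact ⟨x, ⟨_, hx⟩, hx0⟩

theorem exists_add [CompleteSpace E] (hx : IsSwitchedSolution K x) (hL : ∀ B ∈ K, ‖B‖ ≤ L)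
    (hL0 : 0 < L) {v w : E} (h0 : x 0 = v + w) :
    ∃ x₁ x₂, IsSwitchedSolution K x₁ ∧ IsSwitchedSolution K x₂ ∧ x₁ 0 = v ∧ x₂ 0 = w ∧
      ∀ t, x t = x₁ t + x₂ t := by
  obtain ⟨A, hA⟩ := hx
  obtain ⟨x₁, h₁, h₁0⟩ := SwitchedSolution.exists_of_signal hA.meas hA.mem hL hL0 v
  exact ⟨x₁, fun t => x t - x₁ t, ⟨A, h₁⟩, ⟨A, hA.sub h₁ hL⟩, h₁0, by simp [h0, h₁0],
    fun t => by simp⟩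

/-- Solutions of the switched system depend continuously on the initial value. -/
theorem exists_norm_ge_of_near [CompleteSpace E] (hx : IsSwitchedSolution K x)
    (hL : ∀ B ∈ K, ‖B‖ ≤ L) (hL0 : 0 < L) (v : E) :
    ∃ z, IsSwitchedSolution K z ∧ z 0 = v ∧
      ∀ t ≥ (0:ℝ), ‖x t‖ - ‖v - x 0‖ * Real.exp (L * t) ≤ ‖z t‖ := by
  obtain ⟨A, hA⟩ := hx
  obtain ⟨w, hw, hw0⟩ := SwitchedSolution.exists_of_signal hA.meas hA.mem hL hL0 (v - x 0)
  refine ⟨fun t => x t + w t, ⟨A, hA.add hw hL⟩, by simp [hw0], fun t ht => ?_⟩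
  have h1 := hw.norm_le hL hL0.le ht
  rw [hw0] at h1
  have h2 := norm_sub_le (x t + w t) (w t)
  rw [add_sub_cancel_right] at h2
  linarith

theorem exists_tendsto_ultrafilter [FiniteDimensional ℝ E] {ι : Type*} (𝒰 : Ultrafilter ι)
    (hKc : IsClosed K) (hKconv : Convex ℝ K) (hL : ∀ B ∈ K, ‖B‖ ≤ L) (hL0 : 0 ≤ L)
    {x : ι → ℝ → E} (h : ∀ k, IsSwitchedSolution K (x k)) {R : ℝ} (hR : ∀ k, ‖x k 0‖ ≤ R) :
    ∃ z, IsSwitchedSolution K z ∧ ∀ t ≥ (0:ℝ), Tendsto (fun k => x k t) 𝒰 (𝓝 (z t)) := by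
  choose A hA using h
  obtain ⟨B, z, hB, hz⟩ := SwitchedSolution.exists_tendsto_ultrafilter 𝒰 hKc hKconv hL hL0 hA hR
  exact ⟨z, ⟨B, hB⟩, hz⟩

theorem map_mem_of_forall_mem [FiniteDimensional ℝ E] (hL : ∀ B ∈ K, ‖B‖ ≤ L) (hL0 : 0 < L)
    {W : Submodule ℝ E}
    (hW : ∀ x, IsSwitchedSolution K x → x 0 ∈ W → ∀ t ≥ (0:ℝ), x t ∈ W)
    {B : E →L[ℝ] E} (hB : B ∈ K) {w : E} (hw : w ∈ W) : B w ∈ W := by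
  have : CompleteSpace E := FiniteDimensional.complete ℝ E
  obtain ⟨x, hx, rfl⟩ := SwitchedSolution.exists_of_signal (A := fun _ => B)
    stronglyMeasurable_const (fun _ => hB) hL hL0 w
  set C := L * (L * (‖x 0‖ * Real.exp (L * 1)))
  have hlim : Tendsto (fun t : ℝ => t⁻¹ • (x t - x 0)) (𝓝[>] 0) (𝓝 (B (x 0))) := by
    rw [tendsto_iff_norm_sub_tendsto_zero]
    have hCt : Tendsto (fun t : ℝ => C * t) (𝓝[>] 0) (𝓝 0) := by
      have : Tendsto (fun t : ℝ => C * t) (𝓝 0) (𝓝 (C * 0)) :=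
        (continuous_const_mul C).tendsto 0
      rw [mul_zero] at this
      exact this.mono_left nhdsWithin_le_nhds
    refine squeeze_zero' (Eventually.of_forall fun t => norm_nonneg _) ?_ hCt
    filter_upwards [Ioo_mem_nhdsGT (zero_lt_one' ℝ)] with t ht
    have h1 := hx.norm_sub_sub_le hL hL0.le (a := 0) (b := t) (T := 1) ⟨le_rfl, zero_le_one⟩
      ⟨ht.1.le, ht.2.le⟩
    simp only [intervalIntegral.integral_const, sub_zero, abs_of_pos ht.1] at h1
    have e : t⁻¹ • (x t - x 0) - B (x 0) = t⁻¹ • (x t - x 0 - (t • B) (x 0)) := by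
      rw [smul_sub t⁻¹ (x t - x 0), _root_.smul_apply, smul_smul,
        inv_mul_cancel₀ ht.1.ne', one_smul]
    rw [e, norm_smul, norm_inv, Real.norm_eq_abs, abs_of_pos ht.1, inv_mul_le_iff₀ ht.1]
    exact h1.trans (le_of_eq (by ring))
  refine W.closed_of_finiteDimensional.mem_of_tendsto hlim ?_
  filter_upwards [self_mem_nhdsWithin] with t ht
  exact W.smul_mem _ (W.sub_mem (hW x ⟨_, hx⟩ hw t (le_of_lt ht)) hw)

theorem exists_norm_gt_of_unbounded [FiniteDimensional ℝ E] (hL : ∀ B ∈ K, ‖B‖ ≤ L) (hL0 : 0 < L)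
    (hunb : ∀ v : E, v ≠ 0 → ∀ R : ℝ,
      ∃ x, IsSwitchedSolution K x ∧ x 0 = v ∧ ∃ t ≥ (0:ℝ), R < ‖x t‖) (G : ℝ) :
    ∃ N : ℕ, ∀ v : E, v ≠ 0 →
      ∃ x, IsSwitchedSolution K x ∧ x 0 = v ∧ ∃ t ≥ (0:ℝ), t ≤ N ∧ G * ‖v‖ < ‖x t‖ := by
  have : CompleteSpace E := FiniteDimensional.complete ℝ E
  have : ProperSpace E := FiniteDimensional.proper_real E
  suffices H : ∃ N : ℕ, ∀ v : E, ‖v‖ = 1 →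
      ∃ x, IsSwitchedSolution K x ∧ x 0 = v ∧ ∃ t ≥ (0:ℝ), t ≤ N ∧ G < ‖x t‖ by
    obtain ⟨N, hN⟩ := H
    refine ⟨N, fun v hv => ?_⟩
    have hv' : 0 < ‖v‖ := norm_pos_iff.2 hv
    obtain ⟨x, hx, hx0, t, ht, htN, hG⟩ := hN (‖v‖⁻¹ • v) (by
      rw [norm_smul, norm_inv, norm_norm, inv_mul_cancel₀ hv'.ne'])
    refine ⟨fun t => ‖v‖ • x t, hx.smul _, ?_, t, ht, htN, ?_⟩
    · change ‖v‖ • x 0 = v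
      rw [hx0, smul_smul, mul_inv_cancel₀ hv'.ne', one_smul]
    · rw [norm_smul, norm_norm, mul_comm]
      exact mul_lt_mul_of_pos_left hG hv'
  by_contra! H
  choose v hv hbd using H
  obtain ⟨v₀, hv₀⟩ := (hyperfilter ℕ).exists_tendsto_of_norm_le (fun k => (hv k).le)
  have hv₀1 : ‖v₀‖ = 1 := tendsto_nhds_unique hv₀.norm (by simp only [hv]; exact tendsto_const_nhds)
  obtain ⟨x, hx, hx0, t, ht, hGt⟩ := hunb v₀ (by rintro rfl; simp at hv₀1) G
  have hlim : Tendsto (fun k => ‖x t‖ - ‖v k - x 0‖ * Real.exp (L * t)) (hyperfilter ℕ)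
      (𝓝 ‖x t‖) := by
    have h1 : Tendsto (fun k => ‖v k - x 0‖) (hyperfilter ℕ) (𝓝 0) := by
      rw [hx0]
      exact tendsto_iff_norm_sub_tendsto_zero.1 hv₀
    simpa using tendsto_const_nhds.sub (h1.mul_const (Real.exp (L * t)))
  have hN : ∀ᶠ k : ℕ in (hyperfilter ℕ : Filter ℕ), t ≤ (k : ℝ) :=
    (Nat.hyperfilter_le_atTop) (tendsto_natCast_atTop_atTop.eventually (eventually_ge_atTop t))
  obtain ⟨k, hk, hkt⟩ := ((hlim.eventually (lt_mem_nhds hGt)).and hN).exists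
  obtain ⟨z, hz, hz0, hzt⟩ := hx.exists_norm_ge_of_near hL hL0 (v k)
  exact absurd (hbd k z hz hz0 t ht hkt) (not_le.2 (hk.trans_le (hzt t ht)))

/-- If no nonzero orbit is bounded, then some solution grows exponentially. -/
theorem exists_exp_growth_of_unbounded [FiniteDimensional ℝ E] [Nontrivial E] (hne : K.Nonempty)
    (hKc : IsClosed K) (hKconv : Convex ℝ K) (hL : ∀ B ∈ K, ‖B‖ ≤ L) (hL0 : 0 < L)
    (hunb : ∀ v : E, v ≠ 0 → ∀ R : ℝ,
      ∃ x, IsSwitchedSolution K x ∧ x 0 = v ∧ ∃ t ≥ (0:ℝ), R < ‖x t‖) :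
    ∃ x, IsSwitchedSolution K x ∧ x 0 ≠ 0 ∧
      ∃ c > 0, ∃ ε > 0, ∀ t ≥ (0:ℝ), c * Real.exp (ε * t) ≤ ‖x t‖ := by
  have : CompleteSpace E := FiniteDimensional.complete ℝ E
  obtain ⟨N, hN⟩ := exists_norm_gt_of_unbounded hL hL0 hunb (2 * Real.exp L)
  obtain ⟨v₀, hv₀⟩ := exists_ne (0 : E)
  have hτ1 : ∀ {x : ℝ → E} {t : ℝ}, IsSwitchedSolution K x → 0 ≤ t →
      2 * Real.exp L * ‖x 0‖ < ‖x t‖ → 1 < t := fun {x t} hx ht h => by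
    by_contra! ht1
    have h1 := hx.norm_le hL hL0.le ht
    have h2 : Real.exp (L * t) ≤ Real.exp L := Real.exp_le_exp.2 (by nlinarith)
    have h3 := Real.exp_pos L
    have h4 := mul_le_mul_of_nonneg_left h2 (norm_nonneg (x 0))
    nlinarith [mul_nonneg h3.le (norm_nonneg (x 0))]
  have hNpos : (0:ℝ) < N := by
    obtain ⟨x, hx, hx0, t, ht, htN, hG⟩ := hN v₀ hv₀
    have := hτ1 hx ht (by rwa [hx0])
    linarith
  set ε := Real.log 2 / N with hε
  have hε0 : 0 < ε := div_pos (Real.log_pos one_lt_two) hNpos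
  have hεN : Real.exp (ε * N) = 2 := by
    rw [hε, div_mul_cancel₀ _ hNpos.ne', Real.exp_log two_pos]
  set c := Real.exp (-((L + ε) * N)) with hc
  have hc0 : 0 < c := Real.exp_pos _
  have hP : ∀ k : ℕ, ∀ v : E, ∃ x, IsSwitchedSolution K x ∧ x 0 = v ∧
      ∀ t ≥ (0:ℝ), t ≤ k → c * ‖v‖ * Real.exp (ε * t) ≤ ‖x t‖ := by
    intro k
    induction k with
    | zero =>
      intro v
      obtain ⟨x, hx, hx0⟩ := exists_of_initial hne hL hL0 v
      refine ⟨x, hx, hx0, fun t ht ht' => ?_⟩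
      obtain rfl : t = 0 := le_antisymm (by simpa using ht') ht
      have : c ≤ 1 := Real.exp_le_one_iff.2 (neg_nonpos.2 (by positivity))
      rw [hx0, mul_zero, Real.exp_zero, mul_one]
      exact mul_le_of_le_one_left (norm_nonneg _) this
    | succ k ih =>
      intro v
      rcases eq_or_ne v 0 with rfl | hv
      · obtain ⟨x, hx, hx0⟩ := exists_of_initial hne hL hL0 (0 : E)
        exact ⟨x, hx, hx0, fun t _ _ => by simp⟩
      obtain ⟨x, hx, hx0, τ, hτ, hτN, hG⟩ := hN v hv
      have hτ' : 1 < τ := hτ1 hx hτ (by rwa [hx0])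
      have hGx : 2 * ‖v‖ ≤ ‖x τ‖ := by
        have := Real.one_le_exp hL0.le
        nlinarith [norm_nonneg v]
      obtain ⟨w, hw, hw0, hwt⟩ := ih (x τ)
      refine ⟨_, hx.concat hw hL hτ hw0, by simp [hτ, hx0], fun t ht htk => ?_⟩
      split_ifs with htτ
      · have h1 := hx.norm_zero_le hL hL0.le ht
        rw [hx0] at h1
        have h2 : c * Real.exp (ε * t) * Real.exp (L * t) ≤ 1 := by
          rw [hc, ← Real.exp_add, ← Real.exp_add, Real.exp_le_one_iff]
          nlinarith [mul_nonneg (add_pos hL0 hε0).le (sub_nonneg.2 (htτ.trans hτN))]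
        calc c * ‖v‖ * Real.exp (ε * t) = c * Real.exp (ε * t) * ‖v‖ := by ring
          _ ≤ c * Real.exp (ε * t) * (‖x t‖ * Real.exp (L * t)) := by gcongr
          _ = c * Real.exp (ε * t) * Real.exp (L * t) * ‖x t‖ := by ring
          _ ≤ ‖x t‖ := mul_le_of_le_one_left (norm_nonneg _) h2
      · push_cast at htk
        refine le_trans ?_ (hwt (t - τ) (by linarith) (by linarith))
        have h1 : Real.exp (ε * t) ≤ 2 * Real.exp (ε * (t - τ)) := by
          rw [← hεN, ← Real.exp_add]
          exact Real.exp_le_exp.2 (by nlinarith)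
        calc c * ‖v‖ * Real.exp (ε * t) ≤ c * ‖v‖ * (2 * Real.exp (ε * (t - τ))) := by gcongr
          _ = c * (2 * ‖v‖) * Real.exp (ε * (t - τ)) := by ring
          _ ≤ _ := by gcongr
  choose x hx hx0 hxt using fun k => hP k v₀
  obtain ⟨z, hz, hzt⟩ := exists_tendsto_ultrafilter (hyperfilter ℕ) hKc hKconv hL hL0.le hx
    (R := ‖v₀‖) (fun k => by rw [hx0])
  have hz0 : z 0 = v₀ := tendsto_nhds_unique (hzt 0 le_rfl) (by
    simp only [hx0]
    exact tendsto_const_nhds)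
  refine ⟨z, hz, by rwa [hz0], c * ‖v₀‖, mul_pos hc0 (norm_pos_iff.2 hv₀), ε, hε0, fun t ht => ?_⟩
  refine ge_of_tendsto (hzt t ht).norm ?_
  have hN' : ∀ᶠ k : ℕ in (hyperfilter ℕ : Filter ℕ), t ≤ (k : ℝ) :=
    (Nat.hyperfilter_le_atTop) (tendsto_natCast_atTop_atTop.eventually (eventually_ge_atTop t))
  filter_upwards [hN'] with k hk
  exact hxt k t ht hk

end IsSwitchedSolution

/-- Every solution starting at `v` stays in the closed ball of radius `R` for positive times. -/
def OrbitBound (K : Set (E →L[ℝ] E)) (v : E) (R : ℝ) : Prop :=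
  ∀ x, IsSwitchedSolution K x → x 0 = v → ∀ t ≥ (0:ℝ), ‖x t‖ ≤ R

namespace OrbitBound

variable {K : Set (E →L[ℝ] E)} {v w : E} {L R S : ℝ}

theorem add [CompleteSpace E] (hv : OrbitBound K v R) (hw : OrbitBound K w S)
    (hL : ∀ B ∈ K, ‖B‖ ≤ L) (hL0 : 0 < L) : OrbitBound K (v + w) (R + S) := by
  intro x hx hx0 t ht
  obtain ⟨x₁, x₂, h₁, h₂, h₁0, h₂0, h⟩ := hx.exists_add hL hL0 hx0
  rw [h]
  exact (norm_add_le _ _).trans (add_le_add (hv x₁ h₁ h₁0 t ht) (hw x₂ h₂ h₂0 t ht))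

theorem zero (hL : ∀ B ∈ K, ‖B‖ ≤ L) (hL0 : 0 ≤ L) : OrbitBound K 0 0 := by
  intro x hx hx0 t ht
  simpa [hx0] using hx.norm_le hL hL0 ht

theorem smul (hv : OrbitBound K v R) (hL : ∀ B ∈ K, ‖B‖ ≤ L) (hL0 : 0 ≤ L) (c : ℝ) :
    OrbitBound K (c • v) (|c| * R) := by
  rcases eq_or_ne c 0 with rfl | hc
  · simpa using OrbitBound.zero hL hL0
  intro x hx hx0 t ht
  have h := hv _ (hx.smul c⁻¹) (by simp [hx0, smul_smul, inv_mul_cancel₀ hc]) t ht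
  rwa [norm_smul, norm_inv, Real.norm_eq_abs, inv_mul_le_iff₀ (abs_pos.2 hc)] at h

end OrbitBound

namespace IsSwitchedSolution

variable {K : Set (E →L[ℝ] E)} {L : ℝ}

theorem exists_uniform_bound_of_orbitBound [FiniteDimensional ℝ E] (hne : K.Nonempty)
    (hL : ∀ B ∈ K, ‖B‖ ≤ L) (hL0 : 0 < L) (h : ∀ v : E, ∃ R, OrbitBound K v R) :
    ∃ C > 0, ∀ x, IsSwitchedSolution K x → ∀ t ≥ (0:ℝ), ‖x t‖ ≤ C * ‖x 0‖ := by
  have : CompleteSpace E := FiniteDimensional.complete ℝ E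
  let b := Module.finBasis ℝ E
  choose R hR using fun i => h (b i)
  have hR0 : ∀ i, 0 ≤ R i := fun i => by
    obtain ⟨x, hx, hx0⟩ := exists_of_initial hne hL hL0 (b i)
    exact (norm_nonneg _).trans (hR i x hx hx0 0 le_rfl)
  have hsum : ∀ (c : Fin (Module.finrank ℝ E) → ℝ) (s : Finset (Fin (Module.finrank ℝ E))),
      OrbitBound K (∑ i ∈ s, c i • b i) (∑ i ∈ s, |c i| * R i) := by
    intro c s
    induction s using Finset.induction_on with
    | empty => simpa using OrbitBound.zero hL hL0.le
    | insert i s hi ih =>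
      rw [Finset.sum_insert hi, Finset.sum_insert hi]
      exact ((hR i).smul hL hL0.le (c i)).add ih hL hL0
  let f : Fin (Module.finrank ℝ E) → E →L[ℝ] ℝ :=
    fun i => LinearMap.toContinuousLinearMap (b.coord i)
  refine ⟨∑ i, ‖f i‖ * R i + 1, ?_, fun x hx t ht => ?_⟩
  · have := Finset.sum_nonneg (s := Finset.univ) fun i _ => mul_nonneg (norm_nonneg (f i)) (hR0 i)
    linarith
  have h1 := hsum (fun i => b.repr (x 0) i) Finset.univ x hx (b.sum_repr (x 0)).symm t ht
  have h2 : ∑ i, |b.repr (x 0) i| * R i ≤ ∑ i, ‖f i‖ * R i * ‖x 0‖ := by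
    refine Finset.sum_le_sum fun i _ => ?_
    have h3 : |b.repr (x 0) i| ≤ ‖f i‖ * ‖x 0‖ := (f i).le_opNorm (x 0)
    calc _ ≤ ‖f i‖ * ‖x 0‖ * R i := mul_le_mul_of_nonneg_right h3 (hR0 i)
      _ = _ := by ring
  rw [← Finset.sum_mul] at h2
  rw [add_mul]
  linarith [norm_nonneg (x 0)]

/-- An irreducible system without exponentially growing solutions is uniformly bounded. -/
theorem exists_uniform_bound [FiniteDimensional ℝ E] [Nontrivial E] (hne : K.Nonempty)
    (hKc : IsClosed K) (hKconv : Convex ℝ K) (hL : ∀ B ∈ K, ‖B‖ ≤ L) (hL0 : 0 < L)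
    (hirr : ∀ W : Submodule ℝ E, (∀ A ∈ K, ∀ w ∈ W, A w ∈ W) → W = ⊥ ∨ W = ⊤)
    (hgrow : ¬ ∃ x, IsSwitchedSolution K x ∧ x 0 ≠ 0 ∧
      ∃ c > 0, ∃ ε > 0, ∀ t ≥ (0:ℝ), c * Real.exp (ε * t) ≤ ‖x t‖) :
    ∃ C > 0, ∀ x, IsSwitchedSolution K x → ∀ t ≥ (0:ℝ), ‖x t‖ ≤ C * ‖x 0‖ := by
  have : CompleteSpace E := FiniteDimensional.complete ℝ E
  let U : Submodule ℝ E :=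
    { carrier := {v | ∃ R, OrbitBound K v R}
      zero_mem' := ⟨0, OrbitBound.zero hL hL0.le⟩
      add_mem' := fun ⟨R, hR⟩ ⟨S, hS⟩ => ⟨R + S, hR.add hS hL hL0⟩
      smul_mem' := fun c _ ⟨R, hR⟩ => ⟨|c| * R, hR.smul hL hL0.le c⟩ }
  have hU : ∀ x, IsSwitchedSolution K x → x 0 ∈ U → ∀ t ≥ (0:ℝ), x t ∈ U := by
    rintro x hx ⟨R, hR⟩ t ht
    refine ⟨R, fun y hy hy0 s hs => ?_⟩
    have h := hR _ (hx.concat hy hL ht hy0) (by simp [ht]) (s + t) (by positivity)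
    rcases hs.eq_or_lt with rfl | hs
    · simpa [hy0] using h
    · simpa [hs.not_ge] using h
  rcases hirr U fun A hA w hw => map_mem_of_forall_mem hL hL0 hU hA hw with h | h
  · refine absurd (exists_exp_growth_of_unbounded hne hKc hKconv hL hL0 fun v hv R => ?_) hgrow
    have hvU : v ∉ U := by rwa [h, Submodule.mem_bot]
    by_contra! H
    exact hvU ⟨R, H⟩
  · exact exists_uniform_bound_of_orbitBound hne hL hL0 fun v => by
      have : v ∈ U := h ▸ Submodule.mem_top
      exact this

/-- A uniformly bounded system all of whose solutions tend to zero is uniformly exponentially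
stable. -/
theorem exists_exp_decay_of_tendsto_zero [FiniteDimensional ℝ E]
    (hKc : IsClosed K) (hKconv : Convex ℝ K) (hL : ∀ B ∈ K, ‖B‖ ≤ L) (hL0 : 0 ≤ L) {C : ℝ}
    (hC0 : 0 < C) (hC : ∀ x, IsSwitchedSolution K x → ∀ t ≥ (0:ℝ), ‖x t‖ ≤ C * ‖x 0‖)
    (hlim : ∀ x, IsSwitchedSolution K x → Tendsto (fun t => ‖x t‖) atTop (𝓝 0)) :
    ∃ D, ∃ ε > 0, ∀ x, IsSwitchedSolution K x → ∀ t ≥ (0:ℝ),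
      ‖x t‖ ≤ D * ‖x 0‖ * Real.exp (-(ε * t)) := by
  have hC' : ∀ x, IsSwitchedSolution K x → ∀ s t : ℝ, 0 ≤ s → s ≤ t → ‖x t‖ ≤ C * ‖x s‖ := by
    intro x hx s t hs hst
    simpa using hC _ (hx.shift hL hs) (t - s) (sub_nonneg.2 hst)
  obtain ⟨N, hN⟩ : ∃ N : ℕ, ∀ x, IsSwitchedSolution K x →
      ‖x ((N + 1 : ℕ) : ℝ)‖ ≤ 2⁻¹ * ‖x 0‖ := by
    by_contra! H
    choose x hx hlt using H
    have hx0 : ∀ k, 0 < ‖x k 0‖ := fun k => by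
      have h1 := hC _ (hx k) ((k + 1 : ℕ) : ℝ) (Nat.cast_nonneg _)
      have h2 := hlt k
      by_contra! h3
      have h4 : ‖x k 0‖ = 0 := le_antisymm h3 (norm_nonneg _)
      rw [h4] at h1 h2
      linarith
    obtain ⟨z, hz, hzt⟩ := exists_tendsto_ultrafilter (hyperfilter ℕ) hKc hKconv hL hL0
      (fun k => (hx k).smul (‖x k 0‖⁻¹)) (R := 1) (fun k => by
        rw [norm_smul, norm_inv, norm_norm, inv_mul_cancel₀ (hx0 k).ne'])
    have hge : ∀ t ≥ (0:ℝ), C⁻¹ * 2⁻¹ ≤ ‖z t‖ := fun t ht => by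
      refine ge_of_tendsto (hzt t ht).norm ?_
      have hN' : ∀ᶠ k : ℕ in (hyperfilter ℕ : Filter ℕ), t ≤ (k : ℝ) :=
        (Nat.hyperfilter_le_atTop) (tendsto_natCast_atTop_atTop.eventually (eventually_ge_atTop t))
      filter_upwards [hN'] with k hk
      have h1 := hC' _ (hx k) t ((k + 1 : ℕ) : ℝ) ht (by push_cast; linarith)
      rw [norm_smul, norm_inv, norm_norm, inv_mul_le_iff₀ hC0]
      have h2 := (hlt k).trans_le h1
      have h3 : 2⁻¹ ≤ ‖x k 0‖⁻¹ * (C * ‖x k t‖) := by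
        rw [le_inv_mul_iff₀ (hx0 k)]
        linarith
      linarith
    have h0 := ge_of_tendsto (hlim z hz) ((eventually_ge_atTop (0:ℝ)).mono hge)
    exact absurd h0 (not_le.2 (by positivity))
  set T : ℝ := ((N + 1 : ℕ) : ℝ) with hT
  have hT0 : 0 < T := by positivity
  have hpow : ∀ k : ℕ, ∀ x, IsSwitchedSolution K x → ‖x (k * T)‖ ≤ 2⁻¹ ^ k * ‖x 0‖ := by
    intro k x hx
    induction k with
    | zero => simp
    | succ k ih =>
      have h := hN _ (hx.shift hL (T := k * T) (by positivity))
      rw [zero_add] at h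
      rw [show ((k + 1 : ℕ) : ℝ) * T = T + k * T by push_cast; ring, pow_succ]
      nlinarith
  refine ⟨2 * C, Real.log 2 / T, div_pos (Real.log_pos one_lt_two) hT0, fun x hx t ht => ?_⟩
  set k := ⌊t / T⌋₊
  have hk : (k : ℝ) * T ≤ t := by
    rw [← le_div_iff₀ hT0]
    exact Nat.floor_le (by positivity)
  have hk' : t / T ≤ k + 1 := (Nat.lt_floor_add_one _).le
  have h1 := hC' x hx (k * T) t (by positivity) hk
  have h2 := hpow k x hx
  have h3 : (2⁻¹ : ℝ) ^ k ≤ 2 * Real.exp (-(Real.log 2 / T * t)) := by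
    have e : (2⁻¹ : ℝ) ^ k = Real.exp (-(k * Real.log 2)) := by
      rw [Real.exp_neg, Real.exp_nat_mul, Real.exp_log two_pos, inv_pow]
    have e2 : (2:ℝ) * Real.exp (-(Real.log 2 / T * t))
        = Real.exp (Real.log 2 + -(Real.log 2 / T * t)) := by
      rw [Real.exp_add, Real.exp_log two_pos]
    rw [e, e2]
    refine Real.exp_le_exp.2 ?_
    have := mul_le_mul_of_nonneg_left hk' (Real.log_pos one_lt_two).le
    have e3 : Real.log 2 / T * t = Real.log 2 * (t / T) := by ring
    rw [e3]
    linarith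
  calc ‖x t‖ ≤ C * ‖x (k * T)‖ := h1
    _ ≤ C * (2⁻¹ ^ k * ‖x 0‖) := by gcongr
    _ ≤ C * (2 * Real.exp (-(Real.log 2 / T * t)) * ‖x 0‖) := by gcongr
    _ = _ := by ring

/-- The function `V` assigns to `y` the supremum of the upper limits of `‖x t‖` as `t → ∞` over
all solutions `x` starting at `y`. -/
def IsLimsupValue (K : Set (E →L[ℝ] E)) (V : E → ℝ) : Prop :=
  ∀ y r, V y ≤ r ↔ ∀ x, IsSwitchedSolution K x → x 0 = y → ∀ r' > r, ∀ᶠ t in atTop, ‖x t‖ ≤ r'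

end IsSwitchedSolution

namespace IsSwitchedSolution.IsLimsupValue

variable {K : Set (E →L[ℝ] E)} {L C : ℝ} {V : E → ℝ}

theorem eventually_le (hV : IsLimsupValue K V) {x : ℝ → E} (hx : IsSwitchedSolution K x) {r : ℝ}
    (hr : V (x 0) < r) : ∀ᶠ t in atTop, ‖x t‖ ≤ r :=
  (hV (x 0) (V (x 0))).1 le_rfl x hx rfl r hr

theorem nonneg [CompleteSpace E] (hV : IsLimsupValue K V) (hne : K.Nonempty)
    (hL : ∀ B ∈ K, ‖B‖ ≤ L) (hL0 : 0 < L) (y : E) : 0 ≤ V y := by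
  obtain ⟨x, hx, rfl⟩ := exists_of_initial hne hL hL0 y
  refine le_of_forall_gt_imp_ge_of_dense fun r hr => ?_
  obtain ⟨t, ht⟩ := (hV.eventually_le hx hr).exists
  exact (norm_nonneg _).trans ht

theorem le_mul_norm (hV : IsLimsupValue K V)
    (hC : ∀ x, IsSwitchedSolution K x → ∀ t ≥ (0:ℝ), ‖x t‖ ≤ C * ‖x 0‖) (y : E) :
    V y ≤ C * ‖y‖ := by
  rw [hV]
  rintro x hx rfl r' hr'
  filter_upwards [eventually_ge_atTop (0:ℝ)] with t ht
  exact (hC x hx t ht).trans hr'.le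

theorem add_le [CompleteSpace E] (hV : IsLimsupValue K V) (hL : ∀ B ∈ K, ‖B‖ ≤ L) (hL0 : 0 < L)
    (v w : E) : V (v + w) ≤ V v + V w := by
  rw [hV]
  intro x hx hx0 r' hr'
  obtain ⟨x₁, x₂, h₁, h₂, rfl, rfl, h⟩ := hx.exists_add hL hL0 hx0
  set δ := (r' - (V (x₁ 0) + V (x₂ 0))) / 2
  have hδ : 0 < δ := half_pos (sub_pos.2 hr')
  filter_upwards [hV.eventually_le h₁ (lt_add_of_pos_right _ hδ),
    hV.eventually_le h₂ (lt_add_of_pos_right _ hδ)] with t ht₁ ht₂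
  rw [h]
  refine (norm_add_le _ _).trans ((add_le_add ht₁ ht₂).trans (le_of_eq ?_))
  simp only [δ]
  ring

theorem map_zero [CompleteSpace E] (hV : IsLimsupValue K V) (hne : K.Nonempty)
    (hL : ∀ B ∈ K, ‖B‖ ≤ L) (hL0 : 0 < L) : V 0 = 0 := by
  refine le_antisymm ?_ (hV.nonneg hne hL hL0 0)
  rw [hV]
  intro x hx hx0 r hr
  filter_upwards [eventually_ge_atTop (0:ℝ)] with t ht
  have := hx.norm_le hL hL0.le ht
  rw [hx0, norm_zero, zero_mul] at this
  exact this.trans hr.le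

theorem map_smul [CompleteSpace E] (hV : IsLimsupValue K V) (hne : K.Nonempty)
    (hL : ∀ B ∈ K, ‖B‖ ≤ L) (hL0 : 0 < L) (a : ℝ) (y : E) : V (a • y) = |a| * V y := by
  have hle : ∀ (a : ℝ) (y : E), a ≠ 0 → V (a • y) ≤ |a| * V y := by
    intro a y ha
    have ha' : 0 < |a| := abs_pos.2 ha
    rw [hV]
    intro x hx hx0 r hr
    have h0 : a⁻¹ • x 0 = y := by rw [hx0, smul_smul, inv_mul_cancel₀ ha, one_smul]
    have h := (hV y (V y)).1 le_rfl _ (hx.smul a⁻¹) h0 (|a|⁻¹ * r)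
      (by rwa [gt_iff_lt, lt_inv_mul_iff₀ ha'])
    filter_upwards [h] with t ht
    rw [norm_smul, norm_inv, Real.norm_eq_abs] at ht
    exact le_of_mul_le_mul_left ht (inv_pos.2 ha')
  rcases eq_or_ne a 0 with rfl | ha
  · simp [hV.map_zero hne hL hL0]
  refine le_antisymm (hle a y ha) ?_
  have h := hle a⁻¹ (a • y) (inv_ne_zero ha)
  rw [smul_smul, inv_mul_cancel₀ ha, one_smul, abs_inv] at h
  rwa [le_inv_mul_iff₀ (abs_pos.2 ha)] at h

theorem map_le (hV : IsLimsupValue K V) (hL : ∀ B ∈ K, ‖B‖ ≤ L) {x : ℝ → E}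
    (hx : IsSwitchedSolution K x) {t : ℝ} (ht : 0 ≤ t) : V (x t) ≤ V (x 0) := by
  rw [hV]
  intro y hy hy0 r hr
  have h := (hV (x 0) (V (x 0))).1 le_rfl _ (hx.concat hy hL ht hy0) (by simp [ht]) r hr
  have h' := (tendsto_atTop_add_const_right atTop t tendsto_id).eventually h
  filter_upwards [h', eventually_gt_atTop 0] with s hs hs0
  simpa [not_le.2 hs0] using hs

theorem abs_sub_le [CompleteSpace E] (hV : IsLimsupValue K V) (hL : ∀ B ∈ K, ‖B‖ ≤ L)
    (hL0 : 0 < L) (hC : ∀ x, IsSwitchedSolution K x → ∀ t ≥ (0:ℝ), ‖x t‖ ≤ C * ‖x 0‖) (v w : E) :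
    |V v - V w| ≤ C * ‖v - w‖ := by
  have h : ∀ v w, V v - V w ≤ C * ‖v - w‖ := fun v w => by
    have h1 := hV.add_le hL hL0 (v - w) w
    rw [sub_add_cancel] at h1
    linarith [hV.le_mul_norm hC (v - w)]
  refine abs_sub_le_iff.2 ⟨h v w, ?_⟩
  rw [norm_sub_rev]
  exact h w v

/-- The supremum of the upper limits is attained along an extremal solution. -/
theorem exists_extremal [FiniteDimensional ℝ E] (hV : IsLimsupValue K V)
    (hKc : IsClosed K) (hKconv : Convex ℝ K) (hL : ∀ B ∈ K, ‖B‖ ≤ L) (hL0 : 0 < L)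
    (hC : ∀ x, IsSwitchedSolution K x → ∀ t ≥ (0:ℝ), ‖x t‖ ≤ C * ‖x 0‖) (y : E) :
    ∃ x, IsSwitchedSolution K x ∧ x 0 = y ∧ ∀ t ≥ (0:ℝ), V (x t) = V y := by
  have : CompleteSpace E := FiniteDimensional.complete ℝ E
  have hex : ∀ k : ℕ, ∃ x, IsSwitchedSolution K x ∧ x 0 = y ∧
      ∀ t ≥ (0:ℝ), V y - 1 / ((k : ℝ) + 1) ≤ V (x t) := by
    intro k
    have hk : (0:ℝ) < 1 / ((k : ℝ) + 1) := by positivity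
    have hnot : ¬ V y ≤ V y - 1 / ((k : ℝ) + 1) := by linarith
    rw [hV] at hnot
    push Not at hnot
    obtain ⟨x, hx, hx0, r, hr, hfreq⟩ := hnot
    refine ⟨x, hx, hx0, fun t ht => ?_⟩
    by_contra! hlt
    have h := (hV (x t) (V (x t))).1 le_rfl _ (hx.shift hL ht) (by simp) r (hlt.trans hr)
    have h' := (tendsto_atTop_add_const_right atTop (-t) tendsto_id).eventually h
    obtain ⟨s, hs, hs'⟩ := (hfreq.and_eventually h').exists
    simp only [id, neg_add_cancel_right] at hs'
    exact absurd hs' (not_le.2 (by simpa using hs))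
  choose x hx hx0 hxt using hex
  obtain ⟨z, hz, hzt⟩ := exists_tendsto_ultrafilter (hyperfilter ℕ) hKc hKconv hL hL0.le hx
    (R := ‖y‖) (fun k => by rw [hx0])
  have hz0 : z 0 = y := tendsto_nhds_unique (hzt 0 le_rfl) (by
    simp only [hx0]
    exact tendsto_const_nhds)
  refine ⟨z, hz, hz0, fun t ht => le_antisymm (hz0 ▸ hV.map_le hL hz ht) ?_⟩
  have hVlim : Tendsto (fun k => V (x k t)) (hyperfilter ℕ) (𝓝 (V (z t))) := by
    rw [tendsto_iff_norm_sub_tendsto_zero]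
    have h1 : Tendsto (fun k => C * ‖x k t - z t‖) (hyperfilter ℕ) (𝓝 0) := by
      simpa using (tendsto_iff_norm_sub_tendsto_zero.1 (hzt t ht)).const_mul C
    exact squeeze_zero (fun _ => norm_nonneg _) (fun k => hV.abs_sub_le hL hL0 hC _ _) h1
  have h2 : Tendsto (fun k : ℕ => V y - 1 / ((k : ℝ) + 1)) (hyperfilter ℕ) (𝓝 (V y)) := by
    simpa using (tendsto_const_nhds (x := V y)).sub
      (tendsto_one_div_add_atTop_nhds_zero_nat.mono_left Nat.hyperfilter_le_atTop)
  exact le_of_tendsto_of_tendsto' h2 hVlim fun k => hxt k t ht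

theorem eq_zero_iff [FiniteDimensional ℝ E] (hV : IsLimsupValue K V) (hne : K.Nonempty)
    (hKc : IsClosed K) (hKconv : Convex ℝ K) (hL : ∀ B ∈ K, ‖B‖ ≤ L) (hL0 : 0 < L)
    (hC0 : 0 < C) (hC : ∀ x, IsSwitchedSolution K x → ∀ t ≥ (0:ℝ), ‖x t‖ ≤ C * ‖x 0‖)
    (hirr : ∀ W : Submodule ℝ E, (∀ A ∈ K, ∀ w ∈ W, A w ∈ W) → W = ⊥ ∨ W = ⊤)
    (hdecay : ¬ ∃ D, ∃ ε > 0, ∀ x, IsSwitchedSolution K x → ∀ t ≥ (0:ℝ),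
      ‖x t‖ ≤ D * ‖x 0‖ * Real.exp (-(ε * t))) (y : E) : V y = 0 ↔ y = 0 := by
  have : CompleteSpace E := FiniteDimensional.complete ℝ E
  have h0 := hV.nonneg hne hL hL0
  let W : Submodule ℝ E :=
    { carrier := {v | V v = 0}
      zero_mem' := hV.map_zero hne hL hL0
      add_mem' := fun {v w} (hv : V v = 0) (hw : V w = 0) =>
        le_antisymm ((hV.add_le hL hL0 v w).trans (by rw [hv, hw, add_zero])) (h0 _)
      smul_mem' := fun c v (hv : V v = 0) => by
        change V (c • v) = 0
        rw [hV.map_smul hne hL hL0, hv, mul_zero] }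
  have hW : ∀ x, IsSwitchedSolution K x → x 0 ∈ W → ∀ t ≥ (0:ℝ), x t ∈ W :=
    fun x hx (hx0 : V (x 0) = 0) t ht => le_antisymm (hx0 ▸ hV.map_le hL hx ht) (h0 _)
  have hbot : W = ⊥ := by
    refine (hirr W fun A hA w hw => map_mem_of_forall_mem hL hL0 hW hA hw).resolve_right
      fun htop => hdecay ?_
    refine exists_exp_decay_of_tendsto_zero hKc hKconv hL hL0.le hC0 hC fun x hx => ?_
    have hx0 : V (x 0) = 0 := show x 0 ∈ W from htop ▸ Submodule.mem_top
    refine Metric.tendsto_nhds.2 fun δ hδ => ?_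
    filter_upwards [hV.eventually_le hx (r := δ / 2) (by rw [hx0]; exact half_pos hδ)] with t ht
    rw [dist_zero_right, norm_norm]
    linarith
  have : y ∈ W ↔ y = 0 := by rw [hbot, Submodule.mem_bot]
  exact this

end IsSwitchedSolution.IsLimsupValue

end SwitchedSystems

section Bridge

variable {n : ℕ} {M : Set (Matrix (Fin n) (Fin n) ℝ)}

/-- Matrices as continuous linear operators on Euclidean space. -/
def matrixEquivCLM (n : ℕ) : Matrix (Fin n) (Fin n) ℝ ≃ₗ[ℝ] (Vec n →L[ℝ] Vec n) :=
  Matrix.toEuclideanLin.trans LinearMap.toContinuousLinearMap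

theorem matrixEquivCLM_apply (A : Matrix (Fin n) (Fin n) ℝ) (y : Vec n) :
    matrixEquivCLM n A y = mulE A y := rfl

theorem continuous_matrixEquivCLM : Continuous (matrixEquivCLM n) :=
  (matrixEquivCLM n).toLinearMap.continuous_of_finiteDimensional

theorem isSwitchedSolution_iff {x : ℝ → Vec n} :
    IsSwitchedSolution (matrixEquivCLM n '' M) x ↔ IsSolution M x := by
  constructor
  · rintro ⟨B, hB⟩
    have hmem : ∀ t, (matrixEquivCLM n).symm (B t) ∈ M := fun t => by
      obtain ⟨A, hA, hAB⟩ := hB.mem t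
      rwa [← hAB, LinearEquiv.symm_apply_apply]
    refine ⟨fun t => (matrixEquivCLM n).symm (B t), fun i j => ?_, hmem, hB.cont, ?_⟩
    · have hc : Continuous fun C : Vec n →L[ℝ] Vec n => (matrixEquivCLM n).symm C i j :=
        (continuous_apply_apply i j).comp
          (matrixEquivCLM n).symm.toLinearMap.continuous_of_finiteDimensional
      exact (hc.comp_stronglyMeasurable hB.meas).measurable
    · intro t ht
      simp only [← matrixEquivCLM_apply, LinearEquiv.apply_symm_apply]
      exact hB.eq t ht
  · rintro ⟨A, hmeas, hmem, hcont, heq⟩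
    refine ⟨fun t => matrixEquivCLM n (A t), ?_, fun t => ⟨A t, hmem t, rfl⟩, hcont, heq⟩
    have hA : StronglyMeasurable fun t => (A t : Fin n → Fin n → ℝ) :=
      (measurable_pi_iff.2 fun i => measurable_pi_iff.2 fun j => hmeas i j).stronglyMeasurable
    exact (continuous_matrixEquivCLM (n := n)).comp_stronglyMeasurable hA

theorem eq_bot_or_top_of_mIrreducible (hirr : MIrreducible M) (W : Submodule ℝ (Vec n))
    (hW : ∀ A ∈ matrixEquivCLM n '' M, ∀ w ∈ W, A w ∈ W) : W = ⊥ ∨ W = ⊤ :=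
  hirr W fun A hA x hx => hW _ ⟨A, hA, rfl⟩ x hx

theorem not_exp_growth_of_rhoZero (hrho : rhoZero M) :
    ¬ ∃ x, IsSwitchedSolution (matrixEquivCLM n '' M) x ∧ x 0 ≠ 0 ∧
      ∃ c > 0, ∃ ε > 0, ∀ t ≥ (0:ℝ), c * Real.exp (ε * t) ≤ ‖x t‖ := by
  rintro ⟨x, hx, hx0, c, hc, ε, hε, hxt⟩
  have hev : ∀ᶠ t : ℝ in atTop, ((ε / 2 : ℝ) : EReal) ≤ ((Real.log ‖x t‖ / t : ℝ) : EReal) := by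
    filter_upwards [eventually_gt_atTop (0:ℝ), eventually_ge_atTop (-Real.log c / (ε / 2))]
      with t ht htc
    rw [div_le_iff₀ (half_pos hε)] at htc
    rw [EReal.coe_le_coe_iff, le_div_iff₀ ht]
    have h := Real.log_le_log (by positivity) (hxt t ht.le)
    rw [Real.log_mul hc.ne' (Real.exp_pos _).ne', Real.log_exp] at h
    linarith
  have h1 : ((ε / 2 : ℝ) : EReal) ≤
      limsup (fun t => ((Real.log ‖x t‖ / t : ℝ) : EReal)) atTop :=
    le_limsup_of_frequently_le hev.frequently
  have h2 : ((ε / 2 : ℝ) : EReal) ≤ 0 := by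
    rw [← hrho]
    exact h1.trans (le_sSup ⟨x, isSwitchedSolution_iff.1 hx, hx0, rfl⟩)
  rw [← EReal.coe_zero, EReal.coe_le_coe_iff] at h2
  linarith

theorem not_exp_decay_of_rhoZero {L : ℝ} (hL : ∀ B ∈ matrixEquivCLM n '' M, ‖B‖ ≤ L)
    (hL0 : 0 ≤ L) (hrho : rhoZero M) :
    ¬ ∃ D, ∃ ε > 0, ∀ x, IsSwitchedSolution (matrixEquivCLM n '' M) x → ∀ t ≥ (0:ℝ),
      ‖x t‖ ≤ D * ‖x 0‖ * Real.exp (-(ε * t)) := by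
  rintro ⟨D, ε, hε, hD⟩
  have hle : (0 : EReal) ≤ ((-(ε / 2) : ℝ) : EReal) := by
    rw [← hrho]
    refine sSup_le ?_
    rintro _ ⟨x, hx, hx0, rfl⟩
    have hx' := isSwitchedSolution_iff.2 hx
    have hx0' : 0 < ‖x 0‖ := norm_pos_iff.2 hx0
    have hD0 : 0 < D * ‖x 0‖ := by
      have := hD x hx' 0 le_rfl
      rw [mul_zero, neg_zero, Real.exp_zero, mul_one] at this
      linarith
    refine limsup_le_of_le (by isBoundedDefault) ?_
    filter_upwards [eventually_gt_atTop (0:ℝ),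
      eventually_ge_atTop (Real.log (D * ‖x 0‖) / (ε / 2))] with t ht htD
    rw [div_le_iff₀ (half_pos hε)] at htD
    have hxt : 0 < ‖x t‖ := by
      have := hx0'.trans_le (hx'.norm_zero_le hL hL0 ht.le)
      exact pos_of_mul_pos_left this (Real.exp_pos _).le
    rw [EReal.coe_le_coe_iff, div_le_iff₀ ht]
    have h := Real.log_le_log hxt (hD x hx' t ht.le)
    rw [Real.log_mul hD0.ne' (Real.exp_pos _).ne', Real.log_exp] at h
    linarith
  rw [← EReal.coe_zero, EReal.coe_le_coe_iff] at hle
  linarith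

theorem bNormE_le_iff (y : Vec n) (r : ℝ) :
    BNormE M y ≤ r ↔ ∀ x, IsSwitchedSolution (matrixEquivCLM n '' M) x → x 0 = y →
      ∀ r' > r, ∀ᶠ t in atTop, ‖x t‖ ≤ r' := by
  rw [BNormE, sSup_le_iff]
  constructor
  · intro h x hx hx0 r' hr'
    have h1 := (limsup_le_iff).1 (h _ ⟨x, isSwitchedSolution_iff.1 hx, hx0, rfl⟩) r'
      (EReal.coe_lt_coe_iff.2 hr')
    filter_upwards [h1] with t ht
    exact (EReal.coe_lt_coe_iff.1 ht).le
  · rintro h _ ⟨x, hx, hx0, rfl⟩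
    refine (limsup_le_iff).2 fun s hs => ?_
    obtain ⟨r', hr, hr'⟩ := EReal.lt_iff_exists_real_btwn.1 hs
    filter_upwards [h x (isSwitchedSolution_iff.2 hx) hx0 r' (EReal.coe_lt_coe_iff.1 hr)] with t ht
    exact (EReal.coe_le_coe_iff.2 ht).trans_lt hr'

theorem bNormE_nonneg {y : Vec n} (h : ∃ x, IsSolution M x ∧ x 0 = y) : 0 ≤ BNormE M y := by
  obtain ⟨x, hx, hx0⟩ := h
  refine le_sSup_of_le ⟨x, hx, hx0, rfl⟩ ?_
  exact le_limsup_of_frequently_le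
    (Frequently.of_forall fun t => EReal.coe_nonneg.2 (norm_nonneg _))

end Bridge

theorem stmt0 (n : ℕ) (hn : 0 < n) (M : Set (Matrix (Fin n) (Fin n) ℝ))
    (hne : M.Nonempty) (hcpt : IsCompact M) (hconv : Convex ℝ M)
    (hirr : MIrreducible M) (hrho : rhoZero M) :
    (∀ y : Vec n, BNormE M y ≠ ⊤ ∧ BNormE M y ≠ ⊥) ∧
      IsBarabanov M (fun y => (BNormE M y).toReal) := by
  have : Nontrivial (Vec n) := by
    have : Nonempty (Fin n) := ⟨⟨0, hn⟩⟩
    infer_instance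
  set K := matrixEquivCLM n '' M
  have hKcpt : IsCompact K := hcpt.image continuous_matrixEquivCLM
  have hKc : IsClosed K := hKcpt.isClosed
  have hKne : K.Nonempty := hne.image _
  have hKconv : Convex ℝ K := hconv.linear_image (matrixEquivCLM n).toLinearMap
  obtain ⟨L, hL0, hL⟩ := hKcpt.isBounded.exists_pos_norm_le
  have hKirr := eq_bot_or_top_of_mIrreducible hirr
  obtain ⟨C, hC0, hC⟩ := IsSwitchedSolution.exists_uniform_bound hKne hKc hKconv hL hL0 hKirr
    (not_exp_growth_of_rhoZero hrho)
  have htop : ∀ y : Vec n, BNormE M y ≠ ⊤ := fun y => by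
    refine ne_top_of_le_ne_top (EReal.coe_ne_top (C * ‖y‖)) ((bNormE_le_iff y _).2 ?_)
    rintro x hx rfl r hr
    filter_upwards [eventually_ge_atTop (0:ℝ)] with t ht
    exact (hC x hx t ht).trans hr.le
  have hbot : ∀ y : Vec n, BNormE M y ≠ ⊥ := fun y => by
    obtain ⟨x, hx, hx0⟩ := IsSwitchedSolution.exists_of_initial hKne hL hL0 y
    exact ((EReal.bot_lt_coe 0).trans_le
      (bNormE_nonneg ⟨x, isSwitchedSolution_iff.1 hx, hx0⟩)).ne'
  have hV : IsSwitchedSolution.IsLimsupValue K fun y => (BNormE M y).toReal := fun y r => by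
    rw [← bNormE_le_iff, ← EReal.coe_le_coe_iff, EReal.coe_toReal (htop y) (hbot y)]
  refine ⟨fun y => ⟨htop y, hbot y⟩, ⟨?_, ?_, ?_⟩, ?_, ?_⟩
  · exact hV.eq_zero_iff hKne hKc hKconv hL hL0 hC0 hC hKirr
      (not_exp_decay_of_rhoZero hL hL0.le hrho)
  · exact hV.map_smul hKne hL hL0
  · exact hV.add_le hL hL0
  · exact fun x hx t ht => hV.map_le hL (isSwitchedSolution_iff.2 hx) ht
  · intro y
    obtain ⟨x, hx, hx0, hxt⟩ := hV.exists_extremal hKc hKconv hL hL0 hC y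
    exact ⟨x, isSwitchedSolution_iff.1 hx, hx0, hxt⟩
end
end

section
/- Let v be a Barabanov norm for the linear switched system associated with M. Let x be a v-extremal solution associated with a switching signal Â(·), with x(0) ≠ 0, let T ≥ 0 and let l̂ ∈ ∂v(x(T)). Then there exists a nonzero solution l of the adjoint system associated with Â(·) on [0,T] such that l(T) = l̂, l(t) ∈ ∂v(x(t)) for every t ∈ [0,T], and for almost every t ∈ [0,T] one has l(t)ᵀÂ(t)x(t) = 0 and l(t)ᵀA x(t) ≤ 0 for every A ∈ M. -/
open MeasureTheory Filter Topology RealInnerProductSpace Matrix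

noncomputable section

theorem intervalIntegrable_clm_apply {E F : Type*} [NormedAddCommGroup E] [NormedSpace ℝ E]
    [NormedAddCommGroup F] [NormedSpace ℝ F]
    {C : ℝ → E →L[ℝ] F} (hC : StronglyMeasurable C) {K : ℝ} (hK : ∀ t, ‖C t‖ ≤ K)
    {u : ℝ → E} {a b : ℝ} (hu : ContinuousOn u (Set.uIcc a b)) :
    IntervalIntegrable (fun s => C s (u s)) volume a b := by
  obtain ⟨P, hP⟩ := isCompact_uIcc.exists_bound_of_continuousOn hu
  rw [intervalIntegrable_iff]
  refine IntegrableOn.of_bound (by simp [Set.uIoc]) ?_ (K * P) ?_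
  · exact (ContinuousLinearMap.id ℝ (E →L[ℝ] F)).aestronglyMeasurable_comp₂
      hC.aestronglyMeasurable
      ((hu.mono Set.uIoc_subset_uIcc).aestronglyMeasurable measurableSet_uIoc)
  · filter_upwards [ae_restrict_mem measurableSet_uIoc] with s hs
    exact (C s).le_of_opNorm_le_of_le (hK s) (hP s (Set.uIoc_subset_uIcc hs))

theorem ae_hasDerivAt_of_eq_add_integral {E : Type*} [NormedAddCommGroup E] [NormedSpace ℝ E]
    [CompleteSpace E] {u f : ℝ → E} {a b : ℝ} (hab : a ≤ b)
    (hf : IntervalIntegrable f volume a b)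
    (hu : ∀ t ∈ Set.Icc a b, u t = u a + ∫ s in a..t, f s) :
    ∀ᵐ t, t ∈ Set.Icc a b → HasDerivAt u (f t) t := by
  have ha : ∀ᵐ t : ℝ, t ≠ a := by simp [ae_iff]
  have hb : ∀ᵐ t : ℝ, t ≠ b := by simp [ae_iff]
  filter_upwards [hf.ae_hasDerivAt_integral, ha, hb] with t h hta htb ht
  rw [Set.uIcc_of_le hab] at h
  refine ((h ht a (Set.left_mem_Icc.2 hab)).const_add (u a)).congr_of_eventuallyEq ?_
  filter_upwards [Icc_mem_nhds (lt_of_le_of_ne ht.1 hta.symm) (lt_of_le_of_ne ht.2 htb)]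
    with s hs using hu s hs

theorem exists_continuous_integral_solution {E : Type*} [NormedAddCommGroup E] [NormedSpace ℝ E]
    [CompleteSpace E] {C : ℝ → E →L[ℝ] E} (hC : StronglyMeasurable C) {K : ℝ}
    (hK : ∀ t, ‖C t‖ ≤ K) (a : ℝ) (e : E) :
    ∃ u : ℝ → E, Continuous u ∧ ∀ t, u t = e + ∫ s in a..t, C s (u s) := by
  have hK0 : 0 ≤ K := (norm_nonneg _).trans (hK 0)
  have hint {f : ℝ → E} (hf : Continuous f) (b c : ℝ) :
      IntervalIntegrable (fun s => C s (f s)) volume b c :=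
    intervalIntegrable_clm_apply hC hK hf.continuousOn
  let U : ℕ → ℝ → E := fun k => Nat.rec (fun _ => e) (fun _ f t => ∫ s in a..t, C s (f s)) k
  have hUc (k : ℕ) : Continuous (U k) := by
    induction k with
    | zero => exact continuous_const
    | succ k ih => exact intervalIntegral.continuous_primitive (fun b c => hint ih b c) a
  have hUb (k : ℕ) : ∀ t, ‖U k t‖ ≤ (K * |t - a|) ^ k / k.factorial * ‖e‖ := by
    induction k with
    | zero => intro t; simp [U]
    | succ k ih =>
      intro t
      calc ‖U (k + 1) t‖ ≤ ∫ s in Set.uIoc a t, ‖C s (U k s)‖ :=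
            intervalIntegral.norm_integral_le_integral_norm_uIoc
        _ ≤ ∫ s in Set.uIoc a t, K ^ (k + 1) / k.factorial * ‖e‖ * |s - a| ^ k := by
            refine setIntegral_mono_on ?_ ?_ measurableSet_uIoc fun s _ => ?_
            · exact (intervalIntegrable_iff.1 (hint (hUc k) a t)).norm
            · exact intervalIntegrable_iff.1 (Continuous.intervalIntegrable (by fun_prop) a t)
            · calc ‖C s (U k s)‖ ≤ K * ((K * |s - a|) ^ k / k.factorial * ‖e‖) :=
                    (C s).le_of_opNorm_le_of_le (hK s) (ih s)
                _ = K ^ (k + 1) / k.factorial * ‖e‖ * |s - a| ^ k := by ring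
        _ = (K * |t - a|) ^ (k + 1) / (k + 1).factorial * ‖e‖ := by
            rw [integral_const_mul, integral_pow_abs_sub_uIoc, Nat.factorial_succ]
            push_cast
            rw [mul_pow]
            field_simp
  have hsum (r : ℝ) : Summable fun k : ℕ => (K * r) ^ k / k.factorial * ‖e‖ :=
    (Real.summable_pow_div_factorial _).mul_right _
  have hUr {k : ℕ} {t r : ℝ} (h : |t - a| ≤ r) :
      ‖U k t‖ ≤ (K * r) ^ k / k.factorial * ‖e‖ := (hUb k t).trans (by gcongr)
  have hU (t : ℝ) : HasSum (fun k => U k t) (∑' k, U k t) :=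
    (Summable.of_norm_bounded (hsum _) fun k => hUb k t).hasSum
  refine ⟨fun t => ∑' k, U k t, ?_, fun t => ?_⟩
  · rw [continuous_iff_continuousAt]
    intro t
    refine (continuousOn_tsum (s := Metric.ball a (|t - a| + 1)) (fun k => (hUc k).continuousOn)
      (hsum (|t - a| + 1)) fun k s hs => hUr ?_).continuousAt (Metric.isOpen_ball.mem_nhds ?_)
    · exact (Metric.mem_ball.1 hs).le
    · simp [Real.dist_eq]
  · have h1 : HasSum (fun k => ∫ s in a..t, C s (U k s)) (∫ s in a..t, C s (∑' k, U k s)) := by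
      refine intervalIntegral.hasSum_integral_of_dominated_convergence
        (fun k _ => K * ((K * |t - a|) ^ k / k.factorial * ‖e‖)) (fun k => ?_) (fun k => ?_)
        ?_ ?_ ?_
      · exact (intervalIntegrable_iff.1 (hint (hUc k) a t)).aestronglyMeasurable
      · refine ae_of_all _ fun s hs => (C s).le_of_opNorm_le_of_le (hK s) (hUr ?_)
        exact Set.abs_sub_left_of_mem_uIcc (Set.uIoc_subset_uIcc hs)
      · exact ae_of_all _ fun s _ => (hsum _).mul_left K
      · exact intervalIntegrable_const
      · exact ae_of_all _ fun s _ => (C s).hasSum (hU s)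
    rw [← h1.tsum_eq]
    exact (hU t).summable.tsum_eq_zero_add

theorem inner_eq_of_integral_solution {E : Type*} [NormedAddCommGroup E] [InnerProductSpace ℝ E]
    [CompleteSpace E] {C D : ℝ → E →L[ℝ] E} (hC : StronglyMeasurable C)
    (hD : StronglyMeasurable D) {K L : ℝ} (hK : ∀ t, ‖C t‖ ≤ K) (hL : ∀ t, ‖D t‖ ≤ L)
    (hCD : ∀ t y z, ⟪D t z, y⟫ = ⟪z, C t y⟫) {u w : ℝ → E} {a b : ℝ} (hab : a ≤ b)
    (hu : ContinuousOn u (Set.Icc a b)) (hw : ContinuousOn w (Set.Icc a b))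
    (hui : ∀ t ∈ Set.Icc a b, u t = u a + ∫ s in a..t, C s (u s))
    (hwi : ∀ t ∈ Set.Icc a b, w t = w a - ∫ s in a..t, D s (w s)) :
    ⟪w b, u b⟫ = ⟪w a, u a⟫ := by
  obtain ⟨P, hP⟩ := isCompact_Icc.exists_bound_of_continuousOn hu
  obtain ⟨Q, hQ⟩ := isCompact_Icc.exists_bound_of_continuousOn hw
  have haI : a ∈ Set.Icc a b := Set.left_mem_Icc.2 hab
  have hP0 : 0 ≤ P := (norm_nonneg _).trans (hP a haI)
  have hQ0 : 0 ≤ Q := (norm_nonneg _).trans (hQ a haI)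
  have hK0 : 0 ≤ K := (norm_nonneg _).trans (hK 0)
  have hL0 : 0 ≤ L := (norm_nonneg _).trans (hL 0)
  have hsub {s t : ℝ} (hs : s ∈ Set.Icc a b) (ht : t ∈ Set.Icc a b) :
      Set.uIcc s t ⊆ Set.Icc a b := Set.uIcc_subset_Icc hs ht
  have hCi {s t : ℝ} (hs : s ∈ Set.Icc a b) (ht : t ∈ Set.Icc a b) :
      IntervalIntegrable (fun s => C s (u s)) volume s t :=
    intervalIntegrable_clm_apply hC hK (hu.mono (hsub hs ht))
  have hDi {s t : ℝ} (hs : s ∈ Set.Icc a b) (ht : t ∈ Set.Icc a b) :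
      IntervalIntegrable (fun s => D s (w s)) volume s t :=
    intervalIntegrable_clm_apply hD hL (hw.mono (hsub hs ht))
  have hul {s t : ℝ} (hs : s ∈ Set.Icc a b) (ht : t ∈ Set.Icc a b) :
      ‖u t - u s‖ ≤ K * P * |t - s| := by
    rw [hui t ht, hui s hs, add_sub_add_left_eq_sub,
      intervalIntegral.integral_interval_sub_left (hCi haI ht) (hCi haI hs)]
    refine intervalIntegral.norm_integral_le_of_norm_le_const fun r hr => ?_
    exact (C r).le_of_opNorm_le_of_le (hK r) (hP r (hsub hs ht (Set.uIoc_subset_uIcc hr)))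
  have hwl {s t : ℝ} (hs : s ∈ Set.Icc a b) (ht : t ∈ Set.Icc a b) :
      ‖w t - w s‖ ≤ L * Q * |t - s| := by
    rw [hwi t ht, hwi s hs, sub_sub_sub_cancel_left, norm_sub_rev,
      intervalIntegral.integral_interval_sub_left (hDi haI ht) (hDi haI hs)]
    refine intervalIntegral.norm_integral_le_of_norm_le_const fun r hr => ?_
    exact (D r).le_of_opNorm_le_of_le (hL r) (hQ r (hsub hs ht (Set.uIoc_subset_uIcc hr)))
  have hlip : LipschitzOnWith (Real.toNNReal (L * Q * P + Q * (K * P)))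
      (fun t => ⟪w t, u t⟫) (Set.uIcc a b) := by
    refine LipschitzOnWith.of_dist_le_mul fun t ht s hs => ?_
    rw [Set.uIcc_of_le hab] at ht hs
    rw [Real.coe_toNNReal _ (by positivity), Real.dist_eq, Real.dist_eq,
      show ⟪w t, u t⟫ - ⟪w s, u s⟫ = ⟪w t - w s, u t⟫ + ⟪w s, u t - u s⟫ by
        rw [inner_sub_left, inner_sub_right]; ring]
    calc |⟪w t - w s, u t⟫ + ⟪w s, u t - u s⟫|
        ≤ ‖w t - w s‖ * ‖u t‖ + ‖w s‖ * ‖u t - u s‖ :=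
          (abs_add_le _ _).trans
            (add_le_add (abs_real_inner_le_norm _ _) (abs_real_inner_le_norm _ _))
      _ ≤ L * Q * |t - s| * P + Q * (K * P * |t - s|) := by
          gcongr
          exacts [hwl hs ht, hP t ht, hQ s hs, hul hs ht]
      _ = (L * Q * P + Q * (K * P)) * |t - s| := by ring
  have hderiv : ∀ᵐ t, t ∈ Set.uIcc a b → HasDerivAt (fun t => ⟪w t, u t⟫) 0 t := by
    filter_upwards [ae_hasDerivAt_of_eq_add_integral hab (hCi haI (Set.right_mem_Icc.2 hab)) hui,
      ae_hasDerivAt_of_eq_add_integral (f := fun s => -D s (w s)) hab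
        (hDi haI (Set.right_mem_Icc.2 hab)).neg
        fun t ht => by rw [intervalIntegral.integral_neg, ← sub_eq_add_neg]; exact hwi t ht]
      with t h1 h2 ht
    rw [Set.uIcc_of_le hab] at ht
    refine ((h2 ht).inner ℝ (h1 ht)).congr_deriv ?_
    rw [inner_neg_left, hCD]
    ring
  obtain ⟨c, hc⟩ := hlip.absolutelyContinuousOnInterval.const_of_ae_hasDerivAt_zero hderiv
  exact (hc b Set.right_mem_uIcc).trans (hc a Set.left_mem_uIcc).symm

theorem mulE_eq_toEuclideanCLM {n : ℕ} (A : Matrix (Fin n) (Fin n) ℝ) (y : Vec n) :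
    mulE A y = toEuclideanCLM (n := Fin n) (𝕜 := ℝ) A y := rfl

theorem inner_mulE_transpose {n : ℕ} (A : Matrix (Fin n) (Fin n) ℝ) (y z : Vec n) :
    ⟪mulE Aᵀ z, y⟫ = ⟪z, mulE A y⟫ := by
  rw [mulE_eq_toEuclideanCLM, mulE_eq_toEuclideanCLM, real_inner_comm, inner_toEuclideanCLM,
    inner_toEuclideanCLM, dotProduct_mulVec, vecMul_transpose, dotProduct_comm]

theorem stronglyMeasurable_toEuclideanCLM {n : ℕ} {A : ℝ → Matrix (Fin n) (Fin n) ℝ}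
    (hA : ∀ i j, Measurable fun t => A t i j) :
    StronglyMeasurable fun t => toEuclideanCLM (n := Fin n) (𝕜 := ℝ) (A t) := by
  have h (t : ℝ) : toEuclideanCLM (n := Fin n) (𝕜 := ℝ) (A t) =
      ∑ i, ∑ j, A t i j • toEuclideanCLM (n := Fin n) (𝕜 := ℝ) (Matrix.single i j 1) := by
    conv_lhs => rw [matrix_eq_sum_single (A t)]
    simp only [map_sum, ← map_smul, smul_single, smul_eq_mul, mul_one]
  simp only [h]
  exact Finset.stronglyMeasurable_fun_sum _ fun i _ =>
    Finset.stronglyMeasurable_fun_sum _ fun j _ => (hA i j).stronglyMeasurable.smul_const _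

theorem exists_norm_toEuclideanCLM_le {n : ℕ} {M : Set (Matrix (Fin n) (Fin n) ℝ)}
    (hM : IsCompact M) : ∃ K, ∀ B ∈ M, ‖toEuclideanCLM (n := Fin n) (𝕜 := ℝ) B‖ ≤ K :=
  hM.exists_bound_of_continuousOn
    (LinearMap.continuous_of_finiteDimensional
      (toEuclideanCLM (n := Fin n) (𝕜 := ℝ)).toAlgEquiv.toLinearMap).continuousOn

theorem HasDerivAt.nonpos_of_forall_le {f : ℝ → ℝ} {d a : ℝ} (hf : HasDerivAt f d a)
    (h : ∀ s ≥ a, f s ≤ f a) : d ≤ 0 := by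
  have hs := (hasDerivWithinAt_iff_tendsto_slope' (by simp)).1
    (hf.hasDerivWithinAt (s := Set.Ioi a))
  refine le_of_tendsto hs ?_
  filter_upwards [self_mem_nhdsWithin] with s hs
  rw [slope_def_field]
  exact div_nonpos_of_nonpos_of_nonneg (sub_nonpos.2 (h s (le_of_lt hs)))
    (sub_nonneg.2 (le_of_lt hs))

theorem stmt1 (n : ℕ) (hn : 0 < n) (M : Set (Matrix (Fin n) (Fin n) ℝ))
    (hne : M.Nonempty) (hcpt : IsCompact M) (hconv : Convex ℝ M)
    (v : Vec n → ℝ) (hv : IsBarabanov M v)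
    (A : ℝ → Matrix (Fin n) (Fin n) ℝ) (x : ℝ → Vec n)
    (hx : IsSolutionWith M A x) (hxe : ∀ t ≥ (0:ℝ), v (x t) = v (x 0))
    (hx0 : x 0 ≠ 0) (T : ℝ) (hT : 0 ≤ T)
    (lhat : Vec n) (hlhat : lhat ∈ subdiff v (x T)) :
    ∃ l : ℝ → Vec n, l 0 ≠ 0 ∧ ContinuousOn l (Set.Icc 0 T) ∧
      (∀ t ∈ Set.Icc (0:ℝ) T, l t = l 0 - ∫ s in (0:ℝ)..t, mulE ((A s)ᵀ) (l s)) ∧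
      l T = lhat ∧ (∀ t ∈ Set.Icc (0:ℝ) T, l t ∈ subdiff v (x t)) ∧
      ∀ᵐ t ∂(volume.restrict (Set.Icc (0:ℝ) T)),
        ⟪l t, mulE (A t) (x t)⟫ = 0 ∧ ∀ B ∈ M, ⟪l t, mulE B (x t)⟫ ≤ 0 := by
  obtain ⟨⟨hv0, -, -⟩, hvle, -⟩ := hv
  obtain ⟨hAm, hAM, hxc, hxi⟩ := hx
  obtain ⟨K, hK⟩ := exists_norm_toEuclideanCLM_le hcpt
  obtain ⟨L, hL⟩ := exists_norm_toEuclideanCLM_le (hcpt.image continuous_id.matrix_transpose)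
  let C : ℝ → Vec n →L[ℝ] Vec n := fun t => toEuclideanCLM (n := Fin n) (𝕜 := ℝ) (A t)
  let D : ℝ → Vec n →L[ℝ] Vec n := fun t => toEuclideanCLM (n := Fin n) (𝕜 := ℝ) (A t)ᵀ
  have hC : StronglyMeasurable C := stronglyMeasurable_toEuclideanCLM hAm
  have hD : StronglyMeasurable D := stronglyMeasurable_toEuclideanCLM fun i j => hAm j i
  have hCK (t : ℝ) : ‖C t‖ ≤ K := hK _ (hAM t)
  have hDL (t : ℝ) : ‖D t‖ ≤ L := hL _ ⟨_, hAM t, rfl⟩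
  have hCD (t : ℝ) (y z : Vec n) : ⟪D t z, y⟫ = ⟪z, C t y⟫ := inner_mulE_transpose (A t) y z
  obtain ⟨l, hlc, hl⟩ := exists_continuous_integral_solution hD.neg (K := L)
    (fun t => by simpa using hDL t) T lhat
  have hlT : l T = lhat := by simpa using hl T
  have hli (a t : ℝ) : l t = l a - ∫ s in a..t, D s (l s) := by
    have hi (b c : ℝ) : IntervalIntegrable (fun s => D s (l s)) volume b c :=
      intervalIntegrable_clm_apply hD hDL hlc.continuousOn
    have h1 := hl t
    have h2 := hl a
    simp only [Pi.neg_apply, _root_.neg_apply, intervalIntegral.integral_neg] at h1 h2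
    rw [h1, h2, ← intervalIntegral.integral_add_adjacent_intervals (hi T a) (hi a t)]
    abel
  have hpair {z : ℝ → Vec n} {t : ℝ} (htT : t ≤ T) (hz : ContinuousOn z (Set.Icc t T))
      (hzi : ∀ s ∈ Set.Icc t T, z s = z t + ∫ r in t..s, C r (z r)) :
      ⟪lhat, z T⟫ = ⟪l t, z t⟫ := by
    rw [← hlT]
    exact inner_eq_of_integral_solution hC hD hCK hDL hCD htT hz hlc.continuousOn hzi
      fun s _ => hli t s
  have hxint (t : ℝ) (ht : 0 ≤ t) : IntervalIntegrable (fun s => C s (x s)) volume 0 t :=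
    intervalIntegrable_clm_apply hC hCK
      (hxc.mono (by rw [Set.uIcc_of_le ht]; exact Set.Icc_subset_Ici_self))
  have hlx (t : ℝ) (ht : t ∈ Set.Icc 0 T) : ⟪l t, x t⟫ = v (x t) := by
    rw [← hpair ht.2 (hxc.mono fun s hs => ht.1.trans hs.1), hlhat.1, hxe T hT, hxe t ht.1]
    intro s hs
    have hs0 : 0 ≤ s := ht.1.trans hs.1
    rw [← intervalIntegral.integral_interval_sub_left (hxint s hs0) (hxint t ht.1)]
    rw [hxi s hs0, hxi t ht.1]
    simp only [mulE_eq_toEuclideanCLM, C]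
    abel
  have hly (t : ℝ) (ht : t ∈ Set.Icc 0 T) (y : Vec n) : ⟪l t, y⟫ ≤ v y := by
    obtain ⟨z, hzc, hz⟩ := exists_continuous_integral_solution hC hCK t y
    have hzt : z t = y := by simpa using hz t
    have hsol : IsSolution M fun s => z (t + s) := by
      refine ⟨fun s => A (t + s), fun i j => (hAm i j).comp (measurable_const_add t),
        fun s => hAM _, by fun_prop, fun s _ => ?_⟩
      have := intervalIntegral.integral_comp_add_left (a := 0) (b := s) (fun r => C r (z r)) t
      simp only [add_zero] at this ⊢
      rw [hzt]
      exact (hz (t + s)).trans (congrArg (y + ·) this.symm)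
    have hle := hvle _ hsol (T - t) (sub_nonneg.2 ht.2)
    simp only [add_sub_cancel, add_zero, hzt] at hle
    rw [← hzt, ← hpair ht.2 hzc.continuousOn fun s _ => by rw [hzt]; exact hz s, hzt]
    exact (hlhat.2 _).trans hle
  refine ⟨l, ?_, hlc.continuousOn, fun t _ => hli 0 t, hlT,
    fun t ht => ⟨hlx t ht, hly t ht⟩, ?_⟩
  · intro h
    have h0 := hlx 0 ⟨le_rfl, hT⟩
    rw [h, inner_zero_left] at h0
    exact hx0 ((hv0 _).1 h0.symm)
  · rw [ae_restrict_iff' measurableSet_Icc]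
    have h0 : ∀ᵐ t : ℝ, t ≠ 0 := by simp [ae_iff]
    filter_upwards [ae_hasDerivAt_of_eq_add_integral hT (hxint T hT)
      fun t ht => hxi t ht.1, h0] with t hd ht0 ht
    have htpos : 0 < t := lt_of_le_of_ne ht.1 ht0.symm
    refine ⟨?_, fun B hB => ?_⟩
    · have hmax : IsLocalMax (fun s => ⟪l t, x s⟫) t := by
        filter_upwards [Ici_mem_nhds htpos] with s hs
        rw [hlx t ht, hxe t ht.1, ← hxe s hs]
        exact hly t ht _
      exact hmax.hasDerivAt_eq_zero
        (((innerSL ℝ (l t)).hasFDerivAt (x := x t)).comp_hasDerivAt t (hd ht))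
    · obtain ⟨z, hzc, hz⟩ := exists_continuous_integral_solution
        (C := fun _ => toEuclideanCLM (n := Fin n) (𝕜 := ℝ) B) stronglyMeasurable_const
        (fun _ => hK B hB) 0 (x t)
      have hz0 : z 0 = x t := by simpa using hz 0
      have hsol : IsSolution M z :=
        ⟨fun _ => B, fun _ _ => measurable_const, fun _ => hB, hzc.continuousOn,
          fun s _ => by rw [hz0]; exact hz s⟩
      have hzd : HasDerivAt z (mulE B (x t)) 0 := by
        have hcont : Continuous fun s => toEuclideanCLM (n := Fin n) (𝕜 := ℝ) B (z s) := by
          fun_prop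
        have := (hcont.integral_hasStrictDerivAt 0 0).hasDerivAt.const_add (x t)
        rw [hz0] at this
        exact this.congr_of_eventuallyEq (Eventually.of_forall hz)
      refine HasDerivAt.nonpos_of_forall_le (f := fun s => ⟪l t, z s⟫)
        (((innerSL ℝ (l t)).hasFDerivAt (x := z 0)).comp_hasDerivAt 0 hzd) fun s hs => ?_
      rw [hz0, hlx t ht, ← hz0]
      exact (hly t ht _).trans (hvle z hsol s hs)
end
end

section
/- Let v be a Barabanov norm with unit sphere S, let x₀ ∈ S, and let V_{x₀} denote the set of all l ∈ ℝⁿ for which there exist t₀ > 0, a v-extremal solution x with x(t₀) = x₀, and a sequence (t_j) with t_j < t₀ and t_j → t₀ such that l = lim_{j→∞} (x(t_j) − x₀)/(t_j − t₀). If V_{x₀} contains n − 1 linearly independent vectors, then v is Fréchet differentiable at x₀. -/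
open MeasureTheory Filter Topology RealInnerProductSpace Matrix

noncomputable section

def incomingDirs {n : ℕ} (M : Set (Matrix (Fin n) (Fin n) ℝ)) (v : Vec n → ℝ)
    (x₀ : Vec n) : Set (Vec n) :=
  {l | ∃ t₀ > (0:ℝ), ∃ x : ℝ → Vec n, IsExtremal M v x ∧ x t₀ = x₀ ∧
    ∃ tj : ℕ → ℝ, (∀ j, 0 ≤ tj j ∧ tj j < t₀) ∧ Tendsto tj atTop (𝓝 t₀) ∧
      Tendsto (fun j => (tj j - t₀)⁻¹ • (x (tj j) - x₀)) atTop (𝓝 l)}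

namespace IsNorm

variable {n : ℕ} {v : Vec n → ℝ}

lemma nonneg (hv : IsNorm v) (x : Vec n) : 0 ≤ v x := by
  have h0 : v 0 = 0 := (hv.1 0).2 rfl
  have h1 := hv.2.2 x ((-1 : ℝ) • x)
  have h2 := hv.2.1 (-1) x
  simp only [neg_smul, one_smul, add_neg_cancel, h0, abs_neg, abs_one, one_mul] at h1 h2
  linarith

lemma exists_le_mul_norm (hv : IsNorm v) : ∃ C, 0 ≤ C ∧ ∀ x, v x ≤ C * ‖x‖ := by
  have h0 : v 0 = 0 := (hv.1 0).2 rfl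
  refine ⟨∑ i, v (EuclideanSpace.basisFun (Fin n) ℝ i),
    Finset.sum_nonneg fun i _ => hv.nonneg _, fun x => ?_⟩
  calc v x = v (∑ i, x i • EuclideanSpace.basisFun (Fin n) ℝ i) := by
        congr 1
        simpa using ((EuclideanSpace.basisFun (Fin n) ℝ).sum_repr x).symm
    _ ≤ ∑ i, v (x i • EuclideanSpace.basisFun (Fin n) ℝ i) :=
        Finset.le_sum_of_subadditive v h0.le hv.2.2 _ _
    _ ≤ ∑ i, v (EuclideanSpace.basisFun (Fin n) ℝ i) * ‖x‖ := by
        refine Finset.sum_le_sum fun i _ => ?_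
        rw [hv.2.1, mul_comm]
        exact mul_le_mul_of_nonneg_left (by simpa using PiLp.norm_apply_le x i) (hv.nonneg _)
    _ = _ := (Finset.sum_mul ..).symm

lemma continuous (hv : IsNorm v) : Continuous v := by
  obtain ⟨C, hC, hvC⟩ := hv.exists_le_mul_norm
  refine (LipschitzWith.of_le_add_mul ⟨C, hC⟩ fun x y => ?_).continuous
  have h1 := hv.2.2 y (x - y)
  have h2 := hvC (x - y)
  rw [add_sub_cancel] at h1
  rw [dist_eq_norm]
  exact h1.trans (add_le_add_right h2 _)

lemma subdiff_nonempty (hv : IsNorm v) (x : Vec n) : (subdiff v x).Nonempty := by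
  rcases eq_or_ne x 0 with rfl | hx
  · exact ⟨0, by simp [(hv.1 0).2 rfl], fun y => by simpa using hv.nonneg y⟩
  · obtain ⟨g, hg, hgv⟩ := exists_extension_of_le_sublinear
      (LinearPMap.mkSpanSingleton (K := ℝ) x (v x) hx) v
      (fun c hc y => by rw [hv.2.1, abs_of_pos hc]) hv.2.2 (by
        rintro ⟨y, hy⟩
        obtain ⟨c, rfl⟩ := Submodule.mem_span_singleton.1 hy
        refine (LinearPMap.mkSpanSingleton'_apply x (v x) _ c hy).trans_le ?_
        rw [hv.2.1, smul_eq_mul]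
        exact mul_le_mul_of_nonneg_right (le_abs_self c) (hv.nonneg x))
    have key (y : Vec n) :
        ⟪(InnerProductSpace.toDual ℝ (Vec n)).symm (LinearMap.toContinuousLinearMap g), y⟫
          = g y := by
      simp
    refine ⟨(InnerProductSpace.toDual ℝ (Vec n)).symm (LinearMap.toContinuousLinearMap g), ?_,
      fun y => (key y).trans_le (hgv y)⟩
    rw [key]
    have hx1 : (1 : ℝ) • x ∈ Submodule.span ℝ {x} :=
      Submodule.smul_mem _ _ (Submodule.mem_span_singleton_self x)
    have h1 : g ((1 : ℝ) • x) = (1 : ℝ) • v x := (hg ⟨(1 : ℝ) • x, hx1⟩).trans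
      (LinearPMap.mkSpanSingleton'_apply x (v x) _ 1 hx1)
    simpa using h1

lemma isCompact_dual_ball (hv : IsNorm v) : IsCompact {l : Vec n | ∀ y, ⟪l, y⟫ ≤ v y} := by
  obtain ⟨C, hC, hvC⟩ := hv.exists_le_mul_norm
  refine Metric.isCompact_of_isClosed_isBounded ?_ ?_
  · simp only [Set.ofPred_forall]
    exact isClosed_iInter fun y => isClosed_le (by fun_prop) continuous_const
  · refine (Metric.isBounded_closedBall (x := (0 : Vec n)) (r := C)).subset fun l hl => ?_
    rw [mem_closedBall_zero_iff]
    rcases eq_or_ne l 0 with rfl | h0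
    · simpa using hC
    · have h1 := (hl l).trans (hvC l)
      rw [real_inner_self_eq_norm_mul_norm] at h1
      exact le_of_mul_le_mul_right h1 (norm_pos_iff.2 h0)

theorem differentiableAt_of_subdiff_subsingleton (hv : IsNorm v) {x : Vec n}
    (hs : (subdiff v x).Subsingleton) : DifferentiableAt ℝ v x := by
  choose q hq using hv.subdiff_nonempty
  have hqx : Tendsto (fun y => ⟪q y, x⟫) (𝓝 x) (𝓝 (v x)) := by
    have hlow : Tendsto (fun y => v y - v (y - x)) (𝓝 x) (𝓝 (v x)) := by
      have hc : Continuous fun y => v y - v (y - x) :=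
        hv.continuous.sub (hv.continuous.comp (continuous_id.sub continuous_const))
      simpa [(hv.1 0).2 rfl] using hc.tendsto x
    refine tendsto_of_tendsto_of_tendsto_of_le_of_le hlow tendsto_const_nhds (fun y => ?_)
      fun y => (hq y).2 x
    have h1 := (hq y).2 (y - x)
    have h2 := (hq y).1
    rw [inner_sub_right] at h1
    simp only
    linarith
  have hlim : Tendsto q (𝓝 x) (𝓝 (q x)) := by
    refine hv.isCompact_dual_ball.tendsto_nhds_of_unique_mapClusterPt
      (Eventually.of_forall fun y => (hq y).2) fun l hl hcl => hs ⟨?_, hl⟩ (hq x)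
    have h1 : MapClusterPt ⟪l, x⟫ (𝓝 x) (fun y => ⟪q y, x⟫) :=
      hcl.continuousAt_comp (f := fun l => ⟪l, x⟫) (by fun_prop)
    have : (𝓝 ⟪l, x⟫ ⊓ 𝓝 (v x)).NeBot := h1.neBot.mono (inf_le_inf_left _ hqx)
    exact eq_of_nhds_neBot this
  refine HasFDerivAt.differentiableAt (f' := innerSL ℝ (q x)) ?_
  rw [hasFDerivAt_iff_isLittleO, Asymptotics.isLittleO_iff]
  intro c hc
  filter_upwards [Metric.tendsto_nhds.1 hlim c hc] with y hy
  rw [dist_eq_norm] at hy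
  have h1 := (hq x).1
  have h2 := (hq y).1
  have h3 := (hq x).2 y
  have h4 := (hq y).2 x
  have h5 : ⟪q y - q x, y - x⟫ ≤ c * ‖y - x‖ :=
    (real_inner_le_norm _ _).trans (mul_le_mul_of_nonneg_right hy.le (norm_nonneg _))
  rw [innerSL_apply_apply, Real.norm_eq_abs, abs_of_nonneg]
  · simp only [inner_sub_left, inner_sub_right] at h5 ⊢
    linarith
  · rw [inner_sub_right]
    linarith

end IsNorm

section Switched

variable {n : ℕ} {M : Set (Matrix (Fin n) (Fin n) ℝ)} {v : Vec n → ℝ}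

lemma isSolution_exp {A : Matrix (Fin n) (Fin n) ℝ} (hA : A ∈ M) (y : Vec n) :
    IsSolution M fun t => NormedSpace.exp (t • Matrix.toEuclideanCLM (𝕜 := ℝ) A) y := by
  set L := Matrix.toEuclideanCLM (𝕜 := ℝ) A with hL
  have hd (t : ℝ) : HasDerivAt (fun t : ℝ => NormedSpace.exp (t • L) y)
      (mulE A (NormedSpace.exp (t • L) y)) t :=
    (ContinuousLinearMap.apply ℝ (Vec n) y).hasFDerivAt.comp_hasDerivAt t
      (hasDerivAt_exp_smul_const' L t)
  have hc : Continuous fun t : ℝ => NormedSpace.exp (t • L) y :=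
    continuous_iff_continuousAt.2 fun t => (hd t).continuousAt
  refine ⟨fun _ => A, fun _ _ => measurable_const, fun _ => hA, hc.continuousOn, fun t _ => ?_⟩
  rw [intervalIntegral.integral_eq_sub_of_hasDerivAt (fun s _ => hd s)]
  · simp
  · exact (L.continuous.comp hc).intervalIntegrable _ _

lemma IsBarabanov.inner_mulE_nonpos (hv : IsBarabanov M v)
    {A : Matrix (Fin n) (Fin n) ℝ} (hA : A ∈ M) {x p : Vec n} (hp : p ∈ subdiff v x) :
    ⟪p, mulE A x⟫ ≤ 0 := by
  set L := Matrix.toEuclideanCLM (𝕜 := ℝ) A with hL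
  have hd : HasDerivAt (fun t : ℝ => ⟪p, NormedSpace.exp (t • L) x⟫) ⟪p, mulE A x⟫ 0 := by
    have h1 := ((innerSL ℝ p).comp (ContinuousLinearMap.apply ℝ (Vec n) x)).hasFDerivAt
      |>.comp_hasDerivAt (0 : ℝ) (hasDerivAt_exp_smul_const' L (0 : ℝ))
    rw [zero_smul ℝ L, NormedSpace.exp_zero, mul_one] at h1
    exact h1
  refine le_of_tendsto hd.tendsto_slope_zero_right ?_
  filter_upwards [self_mem_nhdsWithin] with t ht
  have ht : 0 < t := ht
  have h1 := hv.2.1 _ (isSolution_exp hA x) t ht.le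
  have h2 := hp.2 (NormedSpace.exp (t • L) x)
  have h3 := hp.1
  have h4 : NormedSpace.exp ((0 : ℝ) • L) x = x := by
    rw [zero_smul ℝ L, NormedSpace.exp_zero, one_apply_eq_self]
  rw [← hL, h4] at h1
  rw [zero_add, h4]
  exact mul_nonpos_of_nonneg_of_nonpos (inv_nonneg.2 ht.le) (by linarith)

lemma exists_norm_mulE_le (hM : IsCompact M) :
    ∃ C, 0 < C ∧ ∀ A ∈ M, ∀ y, ‖mulE A y‖ ≤ C * ‖y‖ := by
  have hc : Continuous (Matrix.toEuclideanCLM (n := Fin n) (𝕜 := ℝ)) :=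
    LinearMap.continuous_of_finiteDimensional
      (Matrix.toEuclideanCLM (n := Fin n) (𝕜 := ℝ)).toAlgEquiv.toLinearMap
  obtain ⟨C, hC, hMC⟩ := (hM.image hc).isBounded.exists_pos_norm_le
  exact ⟨C, hC, fun A hA y => (Matrix.toEuclideanCLM (𝕜 := ℝ) A).le_of_opNorm_le
    (hMC _ ⟨A, hA, rfl⟩) y⟩

lemma IsSolutionWith.intervalIntegrable (hM : IsCompact M) {A : ℝ → Matrix (Fin n) (Fin n) ℝ}
    {x : ℝ → Vec n} (hx : IsSolutionWith M A x) {a b : ℝ} (ha : 0 ≤ a) (hb : 0 ≤ b) :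
    IntervalIntegrable (fun s => mulE (A s) (x s)) volume a b := by
  obtain ⟨hm, hA, hxc, -⟩ := hx
  have hsub : Set.uIcc a b ⊆ Set.Ici 0 := fun s hs => (le_min ha hb).trans hs.1
  have hsum : (fun s => mulE (A s) (x s)) = fun s => ∑ i, ∑ j,
      (A s i j * x s j) • EuclideanSpace.basisFun (Fin n) ℝ i := by
    funext s
    ext k
    simp [mulE, Matrix.toLpLin_apply, Matrix.mulVec, dotProduct, Finset.sum_apply,
      Pi.single_apply]
  rw [hsum]
  have hterm (i j : Fin n) : IntervalIntegrable
      (fun s => (A s i j * x s j) • EuclideanSpace.basisFun (Fin n) ℝ i) volume a b := by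
    obtain ⟨C, hC⟩ := hM.exists_bound_of_continuousOn
      (f := fun B : Matrix (Fin n) (Fin n) ℝ => B i j) (by fun_prop)
    have hAi : IntervalIntegrable (fun s => A s i j) volume a b :=
      (intervalIntegrable_const (c := C)).mono_fun (hm i j).aestronglyMeasurable
        (Eventually.of_forall fun s => (hC _ (hA s)).trans (le_abs_self C))
    have hxj : ContinuousOn (fun s => x s j) (Set.uIcc a b) :=
      (EuclideanSpace.proj (𝕜 := ℝ) j).continuous.comp_continuousOn (hxc.mono hsub)
    have h := hAi.mul_continuousOn hxj
    exact ⟨h.1.smul_const _, h.2.smul_const _⟩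
  have hfun : (fun s => ∑ i, ∑ j, (A s i j * x s j) • EuclideanSpace.basisFun (Fin n) ℝ i)
      = ∑ i, ∑ j, fun s => (A s i j * x s j) • EuclideanSpace.basisFun (Fin n) ℝ i := by
    funext s
    simp only [Finset.sum_apply]
  rw [hfun]
  exact IntervalIntegrable.sum _ fun i _ => IntervalIntegrable.sum _ fun j _ => hterm i j

lemma IsSolutionWith.sub_eq_integral (hM : IsCompact M) {A : ℝ → Matrix (Fin n) (Fin n) ℝ}
    {x : ℝ → Vec n} (hx : IsSolutionWith M A x) {a b : ℝ} (ha : 0 ≤ a) (hb : 0 ≤ b) :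
    x b - x a = ∫ s in a..b, mulE (A s) (x s) := by
  rw [hx.2.2.2 b hb, hx.2.2.2 a ha, add_sub_add_left_eq_sub,
    intervalIntegral.integral_interval_sub_left (hx.intervalIntegrable hM le_rfl hb)
      (hx.intervalIntegrable hM le_rfl ha)]

theorem IsBarabanov.inner_incomingDirs_eq_zero (hM : IsCompact M) (hv : IsBarabanov M v)
    {x₀ l p : Vec n} (hl : l ∈ incomingDirs M v x₀) (hp : p ∈ subdiff v x₀) :
    ⟪p, l⟫ = 0 := by
  obtain ⟨t₀, ht₀, x, ⟨⟨A, hx⟩, hext⟩, rfl, tj, htj, htlim, hlim⟩ := hl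
  have hlim' : Tendsto (fun j => (tj j - t₀)⁻¹ * ⟪p, x (tj j) - x t₀⟫) atTop (𝓝 ⟪p, l⟫) := by
    simpa only [inner_smul_right] using (tendsto_const_nhds (x := p)).inner (𝕜 := ℝ) hlim
  refine le_antisymm (le_of_forall_pos_le_add fun ε hε => ?_) (ge_of_tendsto' hlim' fun j => ?_)
  · obtain ⟨C, hC, hMC⟩ := exists_norm_mulE_le hM
    have hδ : 0 < ε / ((‖p‖ + 1) * C) := by positivity
    have hxt : ContinuousAt x t₀ := hx.2.2.1.continuousAt (Ici_mem_nhds ht₀)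
    obtain ⟨η, hη, hxη⟩ := Metric.continuousAt_iff.1 hxt _ hδ
    refine le_of_tendsto hlim' ?_
    filter_upwards [Metric.tendsto_nhds.1 htlim η hη] with j hj
    obtain ⟨h0, h1⟩ := htj j
    have hint := hx.intervalIntegrable hM h0 ht₀.le
    have hpt (s : ℝ) (hs : s ∈ Set.Icc (tj j) t₀) : ⟪p, mulE (A s) (x s)⟫ ≤ ε := by
      have hs' : ‖x s - x t₀‖ ≤ ε / ((‖p‖ + 1) * C) := by
        rw [← dist_eq_norm]
        refine (hxη ?_).le
        rw [Real.dist_eq, abs_lt] at hj ⊢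
        constructor <;> linarith [hs.1, hs.2]
      have hdec : mulE (A s) (x s) = mulE (A s) (x t₀) + mulE (A s) (x s - x t₀) := by
        simp only [mulE, map_sub, add_sub_cancel]
      have h2 : ⟪p, mulE (A s) (x s - x t₀)⟫ ≤ ε := calc
        _ ≤ ‖p‖ * ‖mulE (A s) (x s - x t₀)‖ := real_inner_le_norm _ _
        _ ≤ (‖p‖ + 1) * (C * (ε / ((‖p‖ + 1) * C))) := by
          refine mul_le_mul (by linarith) ((hMC _ (hx.2.1 s) _).trans ?_) (norm_nonneg _)
            (by positivity)
          gcongr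
        _ = ε := by field_simp
      rw [hdec, inner_add_right]
      linarith [hv.inner_mulE_nonpos (hx.2.1 s) hp]
    have hle : ⟪p, x t₀ - x (tj j)⟫ ≤ ε * (t₀ - tj j) := by
      have hcomm : ⟪p, x t₀ - x (tj j)⟫ = ∫ s in (tj j)..t₀, ⟪p, mulE (A s) (x s)⟫ := by
        rw [hx.sub_eq_integral hM h0 ht₀.le]
        exact ((innerSL ℝ p).intervalIntegral_comp_comm hint).symm
      rw [hcomm]
      calc _ ≤ ∫ _ in (tj j)..t₀, ε := by
            refine intervalIntegral.integral_mono_on h1.le ?_ intervalIntegrable_const hpt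
            exact ⟨(innerSL ℝ p).integrable_comp hint.1, (innerSL ℝ p).integrable_comp hint.2⟩
        _ = _ := by rw [intervalIntegral.integral_const, smul_eq_mul, mul_comm]
    rw [← neg_sub (x t₀), ← neg_sub t₀, inner_neg_right, inv_neg, neg_mul_neg, zero_add,
      inv_mul_le_iff₀ (by linarith)]
    linarith
  · obtain ⟨h0, h1⟩ := htj j
    have h2 := hp.2 (x (tj j))
    have h3 := hp.1
    have h4 := hext (tj j) h0
    have h5 := hext t₀ ht₀.le
    refine mul_nonneg_of_nonpos_of_nonpos (inv_nonpos.2 (by linarith)) ?_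
    rw [inner_sub_right]
    linarith

end Switched

theorem stmt4 (n : ℕ) (hn : 0 < n) (M : Set (Matrix (Fin n) (Fin n) ℝ))
    (hne : M.Nonempty) (hcpt : IsCompact M) (hconv : Convex ℝ M)
    (v : Vec n → ℝ) (hv : IsBarabanov M v)
    (x₀ : Vec n) (hx₀ : v x₀ = 1)
    (f : Fin (n - 1) → Vec n) (hf : ∀ i, f i ∈ incomingDirs M v x₀)
    (hli : LinearIndependent ℝ f) :
    DifferentiableAt ℝ v x₀ := by
  refine hv.1.differentiableAt_of_subdiff_subsingleton fun p hp q hq => ?_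
  have hpf (i) : ⟪p, f i⟫ = 0 := hv.inner_incomingDirs_eq_zero hcpt (hf i) hp
  have hqf (i) : ⟪q, f i⟫ = 0 := hv.inner_incomingDirs_eq_zero hcpt (hf i) hq
  have hnot : x₀ ∉ Submodule.span ℝ (Set.range f) := fun hmem => by
    have hle : Submodule.span ℝ (Set.range f) ≤ (innerₛₗ ℝ p).ker := by
      rw [Submodule.span_le]
      rintro _ ⟨i, rfl⟩
      exact hpf i
    have h0 : ⟪p, x₀⟫ = 0 := hle hmem
    linarith [hp.1]
  have htop := (linearIndependent_finCons.2 ⟨hli, hnot⟩).span_eq_top_of_card_eq_finrank'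
    (by simp [Nat.sub_add_cancel hn])
  have hle : Submodule.span ℝ (Set.range (Fin.cons x₀ f : Fin (n - 1 + 1) → Vec n))
      ≤ (innerₛₗ ℝ (p - q)).ker := by
    rw [Submodule.span_le]
    rintro _ ⟨i, rfl⟩
    change ⟪p - q, _⟫ = 0
    rw [inner_sub_left]
    refine Fin.cases ?_ (fun i => ?_) i
    · rw [Fin.cons_zero, hp.1, hq.1, sub_self]
    · rw [Fin.cons_succ, hpf, hqf, sub_self]
  have hself : ⟪p - q, p - q⟫ = 0 := hle (htop ▸ Submodule.mem_top)
  exact sub_eq_zero.1 (inner_self_eq_zero.1 hself)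
end
end
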